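/- arXiv:2409.10051 — 3 statements merged into one kernel-verified Lean document; each statement's English description precedes it below -/
import Mathlib

section
/- Let (𝒫, 𝒩) be a Beurling generalized number system whose integers are θ-well-behaved for some θ ∈ [0,1). Then for every fixed α > θ there is a constant C_α (depending only on α and the system) such that for every T > 2, the number of zeros ρ = β + iγ of the analytic continuation of ζ_𝒫 with β ≥ α and |γ| ∈ [T, T+1] is at most C_α log T. -/
open Filter Asymptotics

/-- A Beurling generalized number system: a nondecreasing sequence of generalized
primes `p` with `1 < p 0` tending to infinity, together with the nondecreasing
enumeration `n` (with multiplicity) of all finite products of the generalized primes,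
witnessed by the bijection `equiv` from exponent vectors to indices. -/
structure BeurlingSystem where
  p : ℕ → ℝ
  n : ℕ → ℝ
  one_lt_p : 1 < p 0
  mono_p : Monotone p
  tendsto_p : Tendsto p atTop atTop
  mono_n : Monotone n
  equiv : (ℕ →₀ ℕ) ≃ ℕ
  n_eq : ∀ k : ℕ →₀ ℕ, n (equiv k) = ∏ j ∈ k.support, p j ^ k j

/-- The integer counting function `N_𝒫(x)`. -/
noncomputable def BeurlingSystem.Nint (S : BeurlingSystem) (x : ℝ) : ℕ :=
  {j : ℕ | S.n j ≤ x}.ncard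

/-- `Z` is an analytic continuation of the Beurling zeta function of the system `S`
to the half-plane `Re s > θ`, with density `A`: it agrees with the Dirichlet series
on `Re s > 1` and `Z s - A/(s-1)` is analytic on `Re s > θ`. -/
def BeurlingSystem.IsZeta (S : BeurlingSystem) (θ A : ℝ) (Z : ℂ → ℂ) : Prop :=
  (∀ s : ℂ, 1 < s.re → Z s = ∑' j : ℕ, (S.n j : ℂ) ^ (-s)) ∧
    DifferentiableOn ℂ (fun s => Z s - (A : ℂ) / (s - 1)) {s : ℂ | θ < s.re}

theorem Complex.norm_center_le_mul_pow_card_zeros {f : ℂ → ℂ} {c : ℂ} {r R M : ℝ} (hr : 0 < r)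
    (hrR : r < R) (hf : DifferentiableOn ℂ f (Metric.closedBall c R))
    (hM : ∀ z ∈ Metric.closedBall c R, ‖f z‖ ≤ M) (F : Finset ℂ)
    (hF : ∀ a ∈ F, a ∈ Metric.closedBall c r ∧ f a = 0) :
    ‖f c‖ ≤ M * (r / R) ^ F.card := by
  classical
  have hR : 0 < R := hr.trans hrR
  induction F using Finset.induction_on generalizing f with
  | empty => simpa using hM c (Metric.mem_closedBall_self hR.le)
  | insert a F haF ih =>
    obtain ⟨har, hfa⟩ := hF a (Finset.mem_insert_self a F)
    have har' : ‖a - c‖ ≤ r := by rwa [mem_closedBall_iff_norm] at har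
    have haR : Metric.closedBall c R ∈ nhds a :=
      Metric.closedBall_mem_nhds_of_mem (by rw [mem_ball_iff_norm]; linarith)
    have hM0 : 0 ≤ M := (norm_nonneg _).trans (hM c (Metric.mem_closedBall_self hR.le))
    set h : ℂ → ℂ := fun z =>
      dslope f a z * (((R : ℂ) ^ 2 - (starRingEnd ℂ) (a - c) * (z - c)) / R) with hh
    have hd : DifferentiableOn ℂ h (Metric.closedBall c R) :=
      ((Complex.differentiableOn_dslope haR).2 hf).mul (by fun_prop)
    have hsphere : ∀ z ∈ Metric.sphere c R, ‖h z‖ ≤ M := by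
      intro z hz
      have hzR : ‖z - c‖ = R := by rwa [mem_sphere_iff_norm] at hz
      have hza : z ≠ a := by rintro rfl; linarith
      have hza' : z - a ≠ 0 := sub_ne_zero.2 hza
      have key : (R : ℂ) ^ 2 - (starRingEnd ℂ) (a - c) * (z - c)
          = (starRingEnd ℂ) (z - a) * (z - c) := by
        have h1 : (z - c) * (starRingEnd ℂ) (z - c) = (R : ℂ) ^ 2 := by
          rw [Complex.mul_conj, Complex.normSq_eq_norm_sq, hzR]; push_cast; ring
        rw [← h1]; simp only [map_sub]; ring
      have : ‖h z‖ = ‖f z‖ := by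
        simp only [hh]
        rw [key, dslope_of_ne _ hza, slope_def_field, hfa, sub_zero, norm_mul, norm_div, norm_div,
          norm_mul, Complex.norm_conj, hzR, Complex.norm_real, Real.norm_of_nonneg hR.le]
        have : ‖z - a‖ ≠ 0 := norm_ne_zero_iff.2 hza'
        field_simp
      rw [this]
      exact hM z (Metric.sphere_subset_closedBall hz)
    have hbound : ∀ z ∈ Metric.closedBall c R, ‖h z‖ ≤ M := by
      intro z hz
      refine Complex.norm_le_of_forall_mem_frontier_norm_le Metric.isBounded_ball
        (hd.diffContOnCl_ball subset_rfl) ?_ (by rwa [closure_ball c hR.ne'])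
      intro w hw
      exact hsphere w (frontier_ball c hR.ne' ▸ hw)
    have hzeros : ∀ b ∈ F, b ∈ Metric.closedBall c r ∧ h b = 0 := by
      intro b hb
      obtain ⟨hb1, hb2⟩ := hF b (Finset.mem_insert_of_mem hb)
      refine ⟨hb1, ?_⟩
      have hba : b ≠ a := by rintro rfl; exact haF hb
      simp [hh, dslope_of_ne _ hba, slope_def_field, hfa, hb2]
    have := ih hd hbound hzeros
    rw [Finset.card_insert_of_notMem haF, pow_succ]
    rcases eq_or_ne a c with rfl | hac
    · rw [hfa, norm_zero]; positivity
    · have hac' : 0 < ‖a - c‖ := norm_pos_iff.2 (sub_ne_zero.2 hac)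
      have hc : ‖f c‖ = ‖h c‖ * (‖a - c‖ / R) := by
        simp only [hh]
        rw [dslope_of_ne _ hac.symm, slope_def_field, hfa, sub_self, mul_zero, sub_zero, sub_zero,
          norm_mul, norm_div, norm_div, norm_pow, Complex.norm_real, Real.norm_of_nonneg hR.le,
          norm_sub_rev c a]
        field_simp
      calc ‖f c‖ = ‖h c‖ * (‖a - c‖ / R) := hc
        _ ≤ (M * (r / R) ^ F.card) * (r / R) := by gcongr
        _ = _ := by ring

namespace BeurlingSystem

variable (S : BeurlingSystem)

theorem p_zero_le (i : ℕ) : S.p 0 ≤ S.p i := S.mono_p (Nat.zero_le i)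

theorem one_le_p (i : ℕ) : 1 ≤ S.p i := S.one_lt_p.le.trans (S.p_zero_le i)

theorem n_equiv_zero : S.n (S.equiv 0) = 1 := by
  rw [S.n_eq]; simp

theorem one_le_prod (k : ℕ →₀ ℕ) (s : Finset ℕ) : 1 ≤ ∏ j ∈ s, S.p j ^ k j :=
  Finset.prod_induction (fun j => S.p j ^ k j) (fun x => 1 ≤ x)
    (fun _ _ ha hb => one_le_mul_of_one_le_of_one_le ha hb) le_rfl
    fun j _ => one_le_pow₀ (S.one_le_p j)

theorem one_le_n (j : ℕ) : 1 ≤ S.n j := by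
  obtain ⟨k, rfl⟩ := S.equiv.surjective j
  rw [S.n_eq]
  exact S.one_le_prod k _

theorem n_pos (j : ℕ) : 0 < S.n j := zero_lt_one.trans_le (S.one_le_n j)

theorem p_zero_le_n {j : ℕ} (hj : j ≠ S.equiv 0) : S.p 0 ≤ S.n j := by
  obtain ⟨k, rfl⟩ := S.equiv.surjective j
  have hk : k ≠ 0 := fun h => hj (by rw [h])
  obtain ⟨i, hi⟩ := Finsupp.support_nonempty_iff.2 hk
  rw [S.n_eq, ← Finset.mul_prod_erase _ _ hi]
  have h1 : S.p i ≤ S.p i ^ k i :=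
    le_self_pow₀ (S.one_le_p i) (Finsupp.mem_support_iff.1 hi)
  have h2 := S.one_le_prod k (k.support.erase i)
  have h3 := S.p_zero_le i
  have h4 := S.one_le_p i
  nlinarith

variable {S} {θ A : ℝ}

theorem finite_setOf_n_le (hθ1 : θ < 1) (hA : 0 < A)
    (hwb : (fun x : ℝ => (S.Nint x : ℝ) - A * x) =O[atTop] fun x : ℝ => x ^ θ) (x : ℝ) :
    {j : ℕ | S.n j ≤ x}.Finite := by
  have ho : (fun x : ℝ => (S.Nint x : ℝ) - A * x) =o[atTop] fun x : ℝ => x := by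
    refine hwb.trans_isLittleO ?_
    refine (isLittleO_iff_tendsto' ?_).2 ((tendsto_rpow_neg_atTop (sub_pos.2 hθ1)).congr' ?_)
    · filter_upwards [eventually_gt_atTop 0] with y hy h using absurd h hy.ne'
    · filter_upwards [eventually_gt_atTop 0] with y hy
      rw [neg_sub, Real.rpow_sub_one hy.ne']
  obtain ⟨y, hy, hxy, hy0⟩ := ((ho.def (half_pos hA)).and
    ((eventually_ge_atTop x).and (eventually_gt_atTop 0))).exists
  have hpos : 0 < S.Nint y := by
    rw [Real.norm_eq_abs, Real.norm_of_nonneg hy0.le] at hy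
    have h1 := (abs_le.1 hy).1
    have : 0 < (S.Nint y : ℝ) := by nlinarith
    exact_mod_cast this
  exact (Set.finite_of_ncard_pos hpos).subset fun j (hj : _ ≤ _) => hj.trans hxy

theorem Nint_mono (hfin : ∀ x, {j : ℕ | S.n j ≤ x}.Finite) : Monotone S.Nint := fun _ y hxy =>
  Set.ncard_le_ncard (fun _ (hj : _ ≤ _) => hj.trans hxy) (hfin y)

theorem exists_abs_Nint_sub_le (hθ0 : 0 ≤ θ) (hA : 0 < A)
    (hfin : ∀ x, {j : ℕ | S.n j ≤ x}.Finite)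
    (hwb : (fun x : ℝ => (S.Nint x : ℝ) - A * x) =O[atTop] fun x : ℝ => x ^ θ) :
    ∃ C, 0 < C ∧ ∀ x, 1 ≤ x → |(S.Nint x : ℝ) - A * x| ≤ C * x ^ θ := by
  obtain ⟨C, hC0, hC⟩ := hwb.exists_pos
  obtain ⟨y, hy⟩ := eventually_atTop.1 hC.bound
  refine ⟨C + S.Nint y + A * |y|, by positivity, fun x hx => ?_⟩
  have h1 : 1 ≤ x ^ θ := Real.one_le_rpow hx hθ0
  have hAy : 0 ≤ A * |y| := by positivity
  rcases le_total y x with h | h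
  · have := hy x h
    rw [Real.norm_eq_abs, Real.norm_of_nonneg (by positivity)] at this
    refine this.trans ?_
    gcongr
    have : (0 : ℝ) ≤ S.Nint y := by positivity
    linarith
  · have h2 : (S.Nint x : ℝ) ≤ S.Nint y := by exact_mod_cast Nint_mono hfin h
    have h3 : A * x ≤ A * |y| := by gcongr; exact h.trans (le_abs_self y)
    have h4 : (0 : ℝ) ≤ S.Nint x := by positivity
    have h5 : 0 ≤ A * x := by positivity
    calc |(S.Nint x : ℝ) - A * x| ≤ C + S.Nint y + A * |y| := by rw [abs_le]; constructor <;> linarith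
      _ ≤ _ := le_mul_of_one_le_right (by positivity) h1

theorem summable_n_rpow (hθ1 : θ < 1) (hfin : ∀ x, {j : ℕ | S.n j ≤ x}.Finite) {C : ℝ}
    (hC0 : 0 < C) (hC : ∀ x, 1 ≤ x → |(S.Nint x : ℝ) - A * x| ≤ C * x ^ θ) {σ : ℝ} (hσ : 1 < σ) :
    Summable fun j => S.n j ^ (-σ) := by
  have hlow (j : ℕ) : ((j : ℝ) + 1) ≤ (|A| + C) * S.n j := by
    have h1 : j + 1 ≤ S.Nint (S.n j) := by
      have : Set.ncard (Set.Iic j) ≤ S.Nint (S.n j) :=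
        Set.ncard_le_ncard (fun i hi => S.mono_n hi) (hfin _)
      simpa [Set.ncard_eq_toFinset_card'] using this
    have h2 := (abs_le.1 (hC _ (S.one_le_n j))).2
    have h3 : S.n j ^ θ ≤ S.n j := by
      simpa using Real.rpow_le_rpow_of_exponent_le (S.one_le_n j) hθ1.le
    have h4 : ((j : ℝ) + 1) ≤ S.Nint (S.n j) := by exact_mod_cast h1
    have h5 : A * S.n j ≤ |A| * S.n j := by gcongr; exacts [(S.n_pos j).le, le_abs_self A]
    nlinarith
  have hB : 0 < |A| + C := by positivity
  have hs : Summable fun j : ℕ => (|A| + C) ^ σ * ((j : ℝ) + 1) ^ (-σ) := by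
    refine Summable.mul_left _ ?_
    have := (summable_nat_add_iff 1).2 (Real.summable_nat_rpow.2 (neg_lt_neg hσ))
    simpa using this
  refine hs.of_nonneg_of_le (fun j => Real.rpow_nonneg (S.n_pos j).le _) fun j => ?_
  have h1 : ((|A| + C) * S.n j) ^ (-σ) ≤ ((j : ℝ) + 1) ^ (-σ) :=
    Real.rpow_le_rpow_of_nonpos (by positivity) (hlow j) (by linarith)
  rw [Real.mul_rpow hB.le (S.n_pos j).le] at h1
  calc S.n j ^ (-σ) = (|A| + C) ^ σ * ((|A| + C) ^ (-σ) * S.n j ^ (-σ)) := by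
        rw [← mul_assoc, ← Real.rpow_add hB]; simp
    _ ≤ _ := by gcongr

theorem norm_n_cpow (j : ℕ) (s : ℂ) : ‖(S.n j : ℂ) ^ (-s)‖ = S.n j ^ (-s.re) := by
  rw [Complex.norm_cpow_eq_rpow_re_of_pos (S.n_pos j), Complex.neg_re]

theorem exists_half_le_norm_tsum (hsum : Summable fun j => S.n j ^ (-2 : ℝ)) :
    ∃ σ₁ : ℝ, ∀ s : ℂ, σ₁ ≤ s.re → 1 / 2 ≤ ‖∑' j : ℕ, (S.n j : ℂ) ^ (-s)‖ := by
  set B := ∑' j, S.n j ^ (-2 : ℝ)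
  have hlim : Tendsto (fun x : ℝ => S.p 0 ^ (-x) * B) atTop (nhds 0) := by
    have := (tendsto_rpow_atBot_of_base_gt_one _ S.one_lt_p).comp tendsto_neg_atTop_atBot
    simpa using this.mul_const B
  obtain ⟨x₀, hx₀⟩ := eventually_atTop.1 (hlim.eventually (gt_mem_nhds (half_pos one_pos)))
  refine ⟨max x₀ 0 + 2, fun s hs => ?_⟩
  set x := s.re - 2 with hx
  have hx1 : x₀ ≤ x := by linarith [le_max_left x₀ 0]
  have hx2 : 0 ≤ x := by linarith [le_max_right x₀ 0]
  have hp0 : 0 < S.p 0 := zero_lt_one.trans S.one_lt_p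
  have hsum' : Summable fun j => (S.n j : ℂ) ^ (-s) := by
    refine Summable.of_norm_bounded hsum fun j => ?_
    rw [norm_n_cpow]
    exact Real.rpow_le_rpow_of_exponent_le (S.one_le_n j) (by linarith)
  have hterm (j : ℕ) : ‖if j = S.equiv 0 then (0 : ℂ) else (S.n j : ℂ) ^ (-s)‖
      ≤ S.p 0 ^ (-x) * S.n j ^ (-2 : ℝ) := by
    split_ifs with h
    · rw [norm_zero]
      exact mul_nonneg (Real.rpow_nonneg hp0.le _) (Real.rpow_nonneg (S.n_pos j).le _)
    · rw [norm_n_cpow, show -s.re = -x + (-2) by rw [hx]; ring, Real.rpow_add (S.n_pos j)]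
      refine mul_le_mul_of_nonneg_right ?_ (Real.rpow_nonneg (S.n_pos j).le _)
      exact Real.rpow_le_rpow_of_nonpos hp0 (S.p_zero_le_n h) (by linarith)
  have htail := tsum_of_norm_bounded (hsum.hasSum.mul_left (S.p 0 ^ (-x))) hterm
  rw [hsum'.tsum_eq_add_tsum_ite (S.equiv 0), S.n_equiv_zero]
  have h1 := hx₀ x hx1
  have h2 := norm_sub_norm_le (1 : ℂ)
    (-∑' j, if j = S.equiv 0 then (0 : ℂ) else (S.n j : ℂ) ^ (-s))
  rw [norm_neg, sub_neg_eq_add, norm_one] at h2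
  simp only [Complex.ofReal_one, Complex.one_cpow]
  linarith

/-- The error term `N(x) - A x` of the integer counting function, cut off at `1`. -/
noncomputable def errorTerm (S : BeurlingSystem) (A : ℝ) : ℝ → ℂ :=
  (Set.Ioi (1 : ℝ)).indicator fun x => (((S.Nint x : ℝ) - A * x : ℝ) : ℂ)

theorem norm_errorTerm_le {C : ℝ} (hC0 : 0 < C)
    (hC : ∀ x, 1 ≤ x → |(S.Nint x : ℝ) - A * x| ≤ C * x ^ θ) (x : ℝ) :
    ‖errorTerm S A x‖ ≤ C * |x| ^ θ := by
  unfold errorTerm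
  by_cases hx : x ∈ Set.Ioi (1 : ℝ)
  · have h1 : 1 < x := hx
    rw [Set.indicator_of_mem hx, Complex.norm_real, Real.norm_eq_abs, abs_of_pos (a := x)
      (by linarith)]
    exact hC x h1.le
  · rw [Set.indicator_of_notMem hx, norm_zero]
    positivity

theorem locallyIntegrable_errorTerm (hθ0 : 0 ≤ θ) (hfin : ∀ x, {j : ℕ | S.n j ≤ x}.Finite)
    {C : ℝ} (hC0 : 0 < C) (hC : ∀ x, 1 ≤ x → |(S.Nint x : ℝ) - A * x| ≤ C * x ^ θ) :
    MeasureTheory.LocallyIntegrable (errorTerm S A) := by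
  have hcont : Continuous fun x : ℝ => C * |x| ^ θ :=
    continuous_const.mul (continuous_abs.rpow_const fun _ => Or.inr hθ0)
  refine hcont.locallyIntegrable.mono (Measurable.aestronglyMeasurable ?_) (.of_forall fun x => ?_)
  · refine Measurable.indicator ?_ measurableSet_Ioi
    have h1 : Measurable S.Nint := (Nint_mono hfin).measurable
    have h2 : Measurable fun x => (S.Nint x : ℝ) := measurable_from_top.comp h1
    exact Complex.measurable_ofReal.comp (h2.sub (measurable_id.const_mul A))
  · exact (norm_errorTerm_le hC0 hC x).trans (le_abs_self _)

theorem errorTerm_isBigO_atTop {C : ℝ} (hC0 : 0 < C)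
    (hC : ∀ x, 1 ≤ x → |(S.Nint x : ℝ) - A * x| ≤ C * x ^ θ) :
    errorTerm S A =O[atTop] fun x : ℝ => x ^ (-(-θ)) := by
  refine IsBigO.of_bound C ?_
  filter_upwards [eventually_ge_atTop 0] with x hx
  have := norm_errorTerm_le hC0 hC x
  rw [abs_of_nonneg hx] at this
  rwa [neg_neg, Real.norm_of_nonneg (Real.rpow_nonneg hx _)]

theorem errorTerm_isBigO_zero (b : ℝ) :
    errorTerm S A =O[nhdsWithin 0 (Set.Ioi 0)] fun x : ℝ => x ^ (-b) := by
  refine IsBigO.of_bound 1 ?_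
  filter_upwards [nhdsWithin_le_nhds (Iio_mem_nhds (zero_lt_one (α := ℝ)))] with x hx
  have : x ∉ Set.Ioi (1 : ℝ) := not_lt.2 (le_of_lt (Set.mem_Iio.1 hx))
  rw [errorTerm, Set.indicator_of_notMem this, norm_zero]
  positivity

theorem differentiableAt_mellin_errorTerm (hθ0 : 0 ≤ θ)
    (hfin : ∀ x, {j : ℕ | S.n j ≤ x}.Finite)
    {C : ℝ} (hC0 : 0 < C) (hC : ∀ x, 1 ≤ x → |(S.Nint x : ℝ) - A * x| ≤ C * x ^ θ)
    {s : ℂ} (hs : θ < s.re) : DifferentiableAt ℂ (mellin (errorTerm S A)) (-s) :=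
  mellin_differentiableAt_of_isBigO_rpow (a := -θ) (b := -s.re - 1)
    ((locallyIntegrable_errorTerm hθ0 hfin hC0 hC).locallyIntegrableOn _)
    (errorTerm_isBigO_atTop hC0 hC) (by simpa using hs) (errorTerm_isBigO_zero _) (by simp)

theorem mellinConvergent_errorTerm (hθ0 : 0 ≤ θ) (hfin : ∀ x, {j : ℕ | S.n j ≤ x}.Finite)
    {C : ℝ} (hC0 : 0 < C) (hC : ∀ x, 1 ≤ x → |(S.Nint x : ℝ) - A * x| ≤ C * x ^ θ)
    {s : ℂ} (hs : θ < s.re) : MellinConvergent (errorTerm S A) (-s) :=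
  mellinConvergent_of_isBigO_rpow (a := -θ) (b := -s.re - 1)
    ((locallyIntegrable_errorTerm hθ0 hfin hC0 hC).locallyIntegrableOn _)
    (errorTerm_isBigO_atTop hC0 hC) (by simpa using hs) (errorTerm_isBigO_zero _) (by simp)

theorem mellin_integrand_errorTerm (s : ℂ) :
    (fun t : ℝ => (t : ℂ) ^ (-s - 1) • errorTerm S A t) =
      (Set.Ioi (1 : ℝ)).indicator fun t : ℝ =>
        (t : ℂ) ^ (-s - 1) * (((S.Nint t : ℝ) - A * t : ℝ) : ℂ) := by
  ext t
  by_cases ht : t ∈ Set.Ioi (1 : ℝ) <;> simp [errorTerm, ht]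

theorem mellin_errorTerm (s : ℂ) :
    mellin (errorTerm S A) (-s) = ∫ t in Set.Ioi (1 : ℝ),
      (t : ℂ) ^ (-s - 1) * (((S.Nint t : ℝ) - A * t : ℝ) : ℂ) := by
  rw [mellin, mellin_integrand_errorTerm, MeasureTheory.setIntegral_indicator measurableSet_Ioi,
    Set.inter_eq_right.2 (Set.Ioi_subset_Ioi zero_le_one)]

theorem norm_mellin_errorTerm_le {C : ℝ}
    (hC : ∀ x, 1 ≤ x → |(S.Nint x : ℝ) - A * x| ≤ C * x ^ θ) {s : ℂ} (hs : θ < s.re) :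
    ‖mellin (errorTerm S A) (-s)‖ ≤ C / (s.re - θ) := by
  rw [mellin_errorTerm]
  have hlt : θ - s.re - 1 < -1 := by linarith
  have hint : MeasureTheory.IntegrableOn (fun t : ℝ => C * t ^ (θ - s.re - 1)) (Set.Ioi 1) :=
    (integrableOn_Ioi_rpow_of_lt hlt zero_lt_one).const_mul C
  refine (MeasureTheory.norm_integral_le_of_norm_le hint ?_).trans_eq ?_
  · filter_upwards [MeasureTheory.ae_restrict_mem measurableSet_Ioi] with t ht
    have ht1 : 1 < t := ht
    have ht0 : 0 < t := zero_lt_one.trans ht1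
    rw [norm_mul, Complex.norm_cpow_eq_rpow_re_of_pos ht0, Complex.norm_real, Real.norm_eq_abs]
    calc t ^ (-s - 1).re * |(S.Nint t : ℝ) - A * t| ≤ t ^ (-s - 1).re * (C * t ^ θ) := by
          gcongr; exact hC t ht1.le
      _ = C * t ^ (θ - s.re - 1) := by
          rw [mul_left_comm, ← Real.rpow_add ht0]
          simp only [Complex.sub_re, Complex.neg_re, Complex.one_re]
          ring_nf
  · rw [MeasureTheory.integral_const_mul, integral_Ioi_rpow_of_lt hlt zero_lt_one, Real.one_rpow]
    have h1 : s.re - θ ≠ 0 := by linarith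
    have h2 : θ - s.re - 1 + 1 ≠ 0 := by linarith
    field_simp
    ring

theorem tsum_indicator_n (hfin : ∀ x, {j : ℕ | S.n j ≤ x}.Finite) (g : ℝ → ℂ) (x : ℝ) :
    ∑' j, (Set.Ici (S.n j)).indicator g x = (S.Nint x : ℂ) * g x := by
  have h (j : ℕ) : (Set.Ici (S.n j)).indicator g x =
      {j : ℕ | S.n j ≤ x}.indicator (fun _ => g x) j := by
    by_cases hj : S.n j ≤ x <;> simp [hj]
  simp_rw [h]
  rw [tsum_eq_sum (s := (hfin x).toFinset) fun j hj => by
      rw [Set.indicator_of_notMem]; simpa using hj,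
    Finset.sum_congr rfl fun j hj => Set.indicator_of_mem ((hfin x).mem_toFinset.1 hj) _,
    Finset.sum_const, nsmul_eq_mul, Nint, Set.ncard_eq_toFinset_card _ (hfin x)]

theorem Nint_eq_zero {x : ℝ} (hx : x < 1) : S.Nint x = 0 := by
  rw [Nint, show {j : ℕ | S.n j ≤ x} = ∅ from
    Set.eq_empty_of_forall_notMem fun j hj => (hx.trans_le (S.one_le_n j)).not_ge hj,
    Set.ncard_empty]

theorem tsum_n_cpow_eq_mul_integral (hfin : ∀ x, {j : ℕ | S.n j ≤ x}.Finite) {s : ℂ}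
    (hs : 0 < s.re) (hsum : Summable fun j => S.n j ^ (-s.re)) :
    ∑' j, (S.n j : ℂ) ^ (-s) =
      s * ∫ t in Set.Ioi (1 : ℝ), (S.Nint t : ℂ) * (t : ℂ) ^ (-s - 1) := by
  have hs0 : s ≠ 0 := by rintro rfl; simp at hs
  have hre : (-s - 1).re = -s.re - 1 := by simp
  have hlt : (-s - 1).re < -1 := by rw [hre]; linarith
  set g : ℝ → ℂ := fun t => (t : ℂ) ^ (-s - 1) with hg
  have hint (j : ℕ) : MeasureTheory.Integrable ((Set.Ici (S.n j)).indicator g) := by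
    rw [MeasureTheory.integrable_indicator_iff measurableSet_Ici, integrableOn_Ici_iff_integrableOn_Ioi]
    exact integrableOn_Ioi_cpow_of_lt hlt (S.n_pos j)
  have hnorm (j : ℕ) : ∫ t, ‖(Set.Ici (S.n j)).indicator g t‖ = S.n j ^ (-s.re) / s.re := by
    simp_rw [norm_indicator_eq_indicator_norm]
    rw [MeasureTheory.integral_indicator measurableSet_Ici,
      MeasureTheory.integral_Ici_eq_integral_Ioi,
      MeasureTheory.setIntegral_congr_fun (g := fun t : ℝ => t ^ (-s.re - 1)) measurableSet_Ioi
        fun t ht => by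
          simp only [hg]
          rw [Complex.norm_cpow_eq_rpow_re_of_pos ((S.n_pos j).trans ht), hre],
      integral_Ioi_rpow_of_lt (by linarith) (S.n_pos j), sub_add_cancel, neg_div_neg_eq]
  have hval (j : ℕ) : ∫ t, (Set.Ici (S.n j)).indicator g t = (S.n j : ℂ) ^ (-s) / s := by
    rw [MeasureTheory.integral_indicator measurableSet_Ici,
      MeasureTheory.integral_Ici_eq_integral_Ioi, integral_Ioi_cpow_of_lt hlt (S.n_pos j),
      sub_add_cancel, neg_div_neg_eq]
  have key := (MeasureTheory.hasSum_integral_of_summable_integral_norm hint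
    (by simp_rw [hnorm]; exact hsum.div_const _)).tsum_eq
  simp_rw [hval, tsum_indicator_n hfin g, tsum_div_const] at key
  rw [div_eq_iff hs0] at key
  rw [key, mul_comm, ← MeasureTheory.integral_Ici_eq_integral_Ioi,
    MeasureTheory.setIntegral_eq_integral_of_forall_compl_eq_zero]
  intro t ht
  rw [Nint_eq_zero (not_le.1 ht)]
  simp

theorem tsum_n_cpow_eq_mellin (hθ0 : 0 ≤ θ) (hθ1 : θ < 1)
    (hfin : ∀ x, {j : ℕ | S.n j ≤ x}.Finite) {C : ℝ} (hC0 : 0 < C)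
    (hC : ∀ x, 1 ≤ x → |(S.Nint x : ℝ) - A * x| ≤ C * x ^ θ) {s : ℂ} (hs : 1 < s.re) :
    ∑' j, (S.n j : ℂ) ^ (-s) - (A : ℂ) / (s - 1) = A + s * mellin (errorTerm S A) (-s) := by
  have hs1 : s - 1 ≠ 0 := by
    intro h
    rw [sub_eq_zero.1 h] at hs
    simp at hs
  have hE : MeasureTheory.IntegrableOn (fun t : ℝ =>
      (t : ℂ) ^ (-s - 1) * (((S.Nint t : ℝ) - A * t : ℝ) : ℂ)) (Set.Ioi 1) := by
    have := mellinConvergent_errorTerm hθ0 hfin hC0 hC (hθ1.trans hs)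
    rw [MellinConvergent, mellin_integrand_errorTerm] at this
    rw [← MeasureTheory.integrable_indicator_iff measurableSet_Ioi]
    refine (MeasureTheory.integrableOn_iff_integrable_of_support_subset ?_).1 this
    exact Set.support_indicator_subset.trans (Set.Ioi_subset_Ioi zero_le_one)
  have hlt : (-s).re < -1 := by simpa using hs
  have hP : MeasureTheory.IntegrableOn (fun t : ℝ => (A : ℂ) * (t : ℂ) ^ (-s)) (Set.Ioi 1) :=
    (integrableOn_Ioi_cpow_of_lt hlt zero_lt_one).const_mul _
  rw [tsum_n_cpow_eq_mul_integral hfin (by linarith) (summable_n_rpow hθ1 hfin hC0 hC hs),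
    mellin_errorTerm]
  have hsplit : ∫ t in Set.Ioi (1 : ℝ), (S.Nint t : ℂ) * (t : ℂ) ^ (-s - 1) =
      (∫ t in Set.Ioi (1 : ℝ), (t : ℂ) ^ (-s - 1) * (((S.Nint t : ℝ) - A * t : ℝ) : ℂ)) +
        ∫ t in Set.Ioi (1 : ℝ), (A : ℂ) * (t : ℂ) ^ (-s) := by
    rw [← MeasureTheory.integral_add hE hP]
    refine MeasureTheory.setIntegral_congr_fun measurableSet_Ioi fun t ht => ?_
    have ht0 : (t : ℂ) ≠ 0 := Complex.ofReal_ne_zero.2 (zero_lt_one.trans ht).ne'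
    simp only [Complex.cpow_sub _ _ ht0, Complex.cpow_one]
    push_cast
    field_simp
    ring
  rw [hsplit, MeasureTheory.integral_const_mul, integral_Ioi_cpow_of_lt hlt zero_lt_one]
  have hs2 : -s + 1 ≠ 0 := by rwa [← neg_ne_zero, neg_add, neg_neg, ← sub_eq_add_neg]
  simp only [Complex.ofReal_one, Complex.one_cpow]
  rw [show (-s + 1) = -(s - 1) by ring, neg_div_neg_eq]
  field_simp
  ring

theorem IsZeta.sub_eq_mellin {Z : ℂ → ℂ} (hZ : S.IsZeta θ A Z) (hθ0 : 0 ≤ θ) (hθ1 : θ < 1)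
    (hfin : ∀ x, {j : ℕ | S.n j ≤ x}.Finite) {C : ℝ} (hC0 : 0 < C)
    (hC : ∀ x, 1 ≤ x → |(S.Nint x : ℝ) - A * x| ≤ C * x ^ θ) {s : ℂ} (hs : θ < s.re) :
    Z s - (A : ℂ) / (s - 1) = A + s * mellin (errorTerm S A) (-s) := by
  have hopen : IsOpen {s : ℂ | θ < s.re} := isOpen_lt continuous_const Complex.continuous_re
  have hd : DifferentiableOn ℂ (fun s : ℂ => A + s * mellin (errorTerm S A) (-s))
      {s : ℂ | θ < s.re} := fun w hw =>
    ((differentiableAt_const _).add (differentiableAt_id.mul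
      ((differentiableAt_mellin_errorTerm hθ0 hfin hC0 hC hw).comp w
        differentiableAt_id.neg))).differentiableWithinAt
  refine (hZ.2.analyticOnNhd hopen).eqOn_of_preconnected_of_eventuallyEq (hd.analyticOnNhd hopen)
    (convex_halfSpace_re_gt θ).isPreconnected (z₀ := 2) ?_ ?_ hs
  · simp only [Set.mem_ofPred_eq, Complex.re_ofNat]; linarith
  · have : {s : ℂ | 1 < s.re} ∈ nhds (2 : ℂ) :=
      (isOpen_lt continuous_const Complex.continuous_re).mem_nhds (by simp)
    filter_upwards [this] with w hw
    rw [hZ.1 w hw, tsum_n_cpow_eq_mellin hθ0 hθ1 hfin hC0 hC hw]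

theorem IsZeta.norm_sub_le {Z : ℂ → ℂ} (hZ : S.IsZeta θ A Z) (hθ0 : 0 ≤ θ) (hθ1 : θ < 1)
    (hA : 0 < A) (hfin : ∀ x, {j : ℕ | S.n j ≤ x}.Finite) {C : ℝ} (hC0 : 0 < C)
    (hC : ∀ x, 1 ≤ x → |(S.Nint x : ℝ) - A * x| ≤ C * x ^ θ) {s : ℂ} (hs : θ < s.re) :
    ‖Z s - (A : ℂ) / (s - 1)‖ ≤ A + ‖s‖ * (C / (s.re - θ)) := by
  rw [hZ.sub_eq_mellin hθ0 hθ1 hfin hC0 hC hs]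
  refine (norm_add_le _ _).trans ?_
  rw [norm_mul, Complex.norm_real, Real.norm_of_nonneg hA.le]
  gcongr
  exact norm_mellin_errorTerm_le hC hs

theorem IsZeta.norm_mul_sub_add_le {Z : ℂ → ℂ} (hZ : S.IsZeta θ A Z) (hθ0 : 0 ≤ θ) (hθ1 : θ < 1)
    (hA : 0 < A) (hfin : ∀ x, {j : ℕ | S.n j ≤ x}.Finite) {B : ℝ} (hB0 : 0 < B)
    (hB : ∀ x, 1 ≤ x → |(S.Nint x : ℝ) - A * x| ≤ B * x ^ θ) {δ K T : ℝ} (hδ : 0 < δ) {s : ℂ}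
    (hs : θ + δ ≤ s.re) (hT : 1 ≤ T) (hsK : ‖s‖ ≤ K * T) :
    ‖(s - 1) * (Z s - (A : ℂ) / (s - 1)) + A‖ ≤
      ((K + 1) * (A + K * (B / δ)) + A) * T ^ 2 := by
  have hT0 : 0 < T := by linarith
  have hK : 0 ≤ K := nonneg_of_mul_nonneg_left ((norm_nonneg s).trans hsK) hT0
  have h8 : B / (s.re - θ) ≤ B / δ := by
    gcongr
    linarith
  have h9 : ‖s - 1‖ ≤ (K + 1) * T := by
    refine (_root_.norm_sub_le s 1).trans ?_
    rw [norm_one]; linarith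
  have h10 : ‖Z s - (A : ℂ) / (s - 1)‖ ≤ (A + K * (B / δ)) * T := by
    refine (hZ.norm_sub_le hθ0 hθ1 hA hfin hB0 hB (by linarith)).trans ?_
    have h11 : ‖s‖ * (B / (s.re - θ)) ≤ K * T * (B / δ) :=
      mul_le_mul hsK h8 (div_nonneg hB0.le (by linarith)) (by positivity)
    have h12 : A ≤ A * T := le_mul_of_one_le_right hA.le hT
    linarith
  have h13 : A ≤ A * T ^ 2 := le_mul_of_one_le_right hA.le (one_le_pow₀ hT)
  have h14 := mul_le_mul h9 h10 (norm_nonneg _) (by positivity)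
  refine (norm_add_le _ _).trans ?_
  rw [norm_mul, Complex.norm_real, Real.norm_of_nonneg hA.le]
  linarith

theorem IsZeta.exists_card_zeros_closedBall_le {Z : ℂ → ℂ} (hZ : S.IsZeta θ A Z) (hθ0 : 0 ≤ θ)
    (hθ1 : θ < 1) (hA : 0 < A)
    (hwb : (fun x : ℝ => (S.Nint x : ℝ) - A * x) =O[atTop] fun x : ℝ => x ^ θ)
    {α : ℝ} (hα : θ < α) :
    ∃ σ₀ r C : ℝ, (∀ s : ℂ, σ₀ ≤ s.re → Z s ≠ 0) ∧ 0 ≤ r ∧ (σ₀ - α) ^ 2 + 1 / 4 ≤ r ^ 2 ∧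
      ∀ T t : ℝ, 2 < T → T ≤ |t| → |t| ≤ T + 1 → ∀ F : Finset ℂ,
        (∀ ρ ∈ F, Z ρ = 0 ∧ ρ.im ≠ 0 ∧ ρ ∈ Metric.closedBall (⟨σ₀, t⟩ : ℂ) r) →
          (F.card : ℝ) ≤ C * Real.log T := by
  have hfin := finite_setOf_n_le hθ1 hA hwb
  obtain ⟨B, hB0, hB⟩ := exists_abs_Nint_sub_le hθ0 hA hfin hwb
  obtain ⟨σ₁, hσ₁⟩ := exists_half_le_norm_tsum
    (summable_n_rpow hθ1 hfin hB0 hB (one_lt_two : (1 : ℝ) < 2))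
  set δ := (α - θ) / 2 with hδ
  have hδ0 : 0 < δ := by rw [hδ]; linarith
  set σ₀ := max (max σ₁ 2) (α + 1 / δ) with hσ₀
  have h1 : σ₁ ≤ σ₀ := (le_max_left _ _).trans (le_max_left _ _)
  have h2 : 2 ≤ σ₀ := (le_max_right σ₁ 2).trans (le_max_left _ _)
  have h3 : α + 1 / δ ≤ σ₀ := le_max_right _ _
  have hZbig (s : ℂ) (hs : σ₀ ≤ s.re) : 1 / 2 ≤ ‖Z s‖ := by
    rw [hZ.1 s (by linarith)]
    exact hσ₁ s (by linarith)
  set D := σ₀ - α with hD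
  have hDδ : 1 ≤ D * δ := by
    rw [← div_le_iff₀ hδ0]; linarith
  have hD0 : 0 < D := pos_of_mul_pos_left (zero_lt_one.trans_le hDδ) hδ0.le
  set r := √(D ^ 2 + 1 / 4) with hr
  have hr0 : 0 < r := Real.sqrt_pos.2 (by positivity)
  have hr2 : r ^ 2 = D ^ 2 + 1 / 4 := Real.sq_sqrt (by positivity)
  set R := D + δ with hR
  have hrR : r < R := by
    refine lt_of_pow_lt_pow_left₀ 2 (by positivity) ?_
    rw [hr2, hR]; nlinarith
  have hR0 : 0 < R := hr0.trans hrR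
  set K := σ₀ + 2 + R with hK
  have hK0 : 0 < K := by linarith
  set M := (K + 1) * (A + K * (B / δ)) + A with hM
  have hM0 : 0 < M := by positivity
  have hlogR : 0 < Real.log (R / r) := Real.log_pos ((one_lt_div hr0).2 hrR)
  have hlog2 : 0 < Real.log 2 := Real.log_pos one_lt_two
  refine ⟨σ₀, r, (|Real.log M| / Real.log 2 + 2) / Real.log (R / r), fun s hs h0 => ?_, hr0.le,
    hr2.ge, fun T t hT ht1 ht2 F hF => ?_⟩
  · have := hZbig s hs
    rw [h0, norm_zero] at this
    norm_num at this
  set c : ℂ := ⟨σ₀, t⟩ with hc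
  have hT0 : 0 < T := by linarith
  set f : ℂ → ℂ := fun s => (s - 1) * (Z s - (A : ℂ) / (s - 1)) + A with hf
  have hfZ (s : ℂ) (hs : s.im ≠ 0) : f s = (s - 1) * Z s := by
    have : s - 1 ≠ 0 := fun h => hs (by rw [sub_eq_zero.1 h]; simp)
    simp only [hf]
    field_simp
    ring
  have hre (s : ℂ) (hs : s ∈ Metric.closedBall c R) : θ + δ ≤ s.re := by
    have h4 := (Complex.abs_re_le_norm (s - c)).trans (mem_closedBall_iff_norm.1 hs)
    have h5 := (abs_le.1 h4).1
    simp only [Complex.sub_re, hc] at h5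
    linarith
  have hdiff : DifferentiableOn ℂ f (Metric.closedBall c R) := by
    refine DifferentiableOn.add_const _ ((by fun_prop : DifferentiableOn ℂ (fun s : ℂ => s - 1)
      (Metric.closedBall c R)).mul (hZ.2.mono fun s hs => ?_))
    have := hre s hs
    exact show θ < s.re by linarith
  have hnormc : ‖c‖ ≤ σ₀ + (T + 1) := by
    refine (Complex.norm_le_abs_re_add_abs_im c).trans ?_
    simp only [hc]
    rw [abs_of_nonneg (by linarith : 0 ≤ σ₀)]
    linarith
  have hbound : ∀ s ∈ Metric.closedBall c R, ‖f s‖ ≤ M * T ^ 2 := by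
    intro s hs
    have hsK : ‖s‖ ≤ K * T := by
      have h4 := norm_le_norm_add_norm_sub' s c
      have h5 := mem_closedBall_iff_norm.1 hs
      nlinarith
    exact hZ.norm_mul_sub_add_le hθ0 hθ1 hA hfin hB0 hB hδ0 (hre s hs) (by linarith) hsK
  have hfc : 1 ≤ ‖f c‖ := by
    have him : c.im ≠ 0 := by
      intro h
      rw [show t = 0 from h, abs_zero] at ht1
      linarith
    rw [hfZ c him, norm_mul]
    have h4 := Complex.abs_im_le_norm (c - 1)
    simp only [Complex.sub_im, Complex.one_im, sub_zero] at h4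
    have h5 : T ≤ ‖c - 1‖ := ht1.trans h4
    have h6 := hZbig c le_rfl
    nlinarith
  have hmain := hfc.trans (Complex.norm_center_le_mul_pow_card_zeros hr0 hrR hdiff hbound F
    fun ρ hρ => ⟨(hF ρ hρ).2.2, by rw [hfZ ρ (hF ρ hρ).2.1, (hF ρ hρ).1, mul_zero]⟩)
  have hlog := Real.log_nonneg hmain
  rw [Real.log_mul (by positivity) (by positivity), Real.log_mul hM0.ne' (by positivity),
    Real.log_pow, Real.log_pow, ← inv_div R r, Real.log_inv] at hlog
  push_cast at hlog
  have hlogT : Real.log 2 ≤ Real.log T := Real.log_le_log two_pos hT.le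
  have hMT : Real.log M ≤ |Real.log M| / Real.log 2 * Real.log T := by
    rw [div_mul_eq_mul_div, le_div_iff₀ hlog2]
    exact mul_le_mul (le_abs_self _) hlogT hlog2.le (abs_nonneg _)
  rw [div_mul_eq_mul_div, le_div_iff₀ hlogR]
  linarith

end BeurlingSystem

/-- Lemma 1.2 (local number of zeros): for a Beurling zeta function attached to a
system with `θ`-well-behaved integers, the number of zeros with `β ≥ α` and
`|γ| ∈ [T, T+1]` is `O_α(log T)`. -/
theorem local_zero_count
    (θ : ℝ) (hθ0 : 0 ≤ θ) (hθ1 : θ < 1) (S : BeurlingSystem)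
    (A : ℝ) (hA : 0 < A)
    (hwb : (fun x : ℝ => (S.Nint x : ℝ) - A * x) =O[atTop] fun x : ℝ => x ^ θ)
    (Z : ℂ → ℂ) (hZ : S.IsZeta θ A Z)
    (α : ℝ) (hα : θ < α) :
    ∃ C : ℝ, ∀ T : ℝ, 2 < T →
      ({ρ : ℂ | Z ρ = 0 ∧ α ≤ ρ.re ∧ |ρ.im| ∈ Set.Icc T (T + 1)}.ncard : ℝ)
        ≤ C * Real.log T := by
  classical
  obtain ⟨σ₀, r, C, hZ0, hr0, hr2, hcard⟩ :=
    hZ.exists_card_zeros_closedBall_le hθ0 hθ1 hA hwb hα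
  have hball (ρ : ℂ) (t : ℝ) (h0 : Z ρ = 0) (hre : α ≤ ρ.re) (him : |ρ.im - t| ≤ 1 / 2) :
      ρ ∈ Metric.closedBall (⟨σ₀, t⟩ : ℂ) r := by
    have hσ : ρ.re < σ₀ := lt_of_not_ge fun h => hZ0 ρ h h0
    rw [mem_closedBall_iff_norm]
    refine le_of_sq_le_sq ?_ hr0
    rw [← Complex.normSq_eq_norm_sq, Complex.normSq_apply]
    simp only [Complex.sub_re, Complex.sub_im]
    have := abs_le.1 him
    nlinarith
  refine ⟨2 * C, fun T hT => ?_⟩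
  set E := {ρ : ℂ | Z ρ = 0 ∧ α ≤ ρ.re ∧ |ρ.im| ∈ Set.Icc T (T + 1)}
  rcases E.finite_or_infinite with hfin | hinf
  · have hpos := hcard T (T + 1 / 2) hT (by rw [abs_of_pos] <;> linarith)
      (by rw [abs_of_pos] <;> linarith) {ρ ∈ hfin.toFinset | 0 ≤ ρ.im} ?_
    · have hneg := hcard T (-(T + 1 / 2)) hT (by rw [abs_neg, abs_of_pos] <;> linarith)
        (by rw [abs_neg, abs_of_pos] <;> linarith) {ρ ∈ hfin.toFinset | ¬ 0 ≤ ρ.im} ?_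
      · rw [Set.ncard_eq_toFinset_card _ hfin,
          ← Finset.card_filter_add_card_filter_not (fun ρ : ℂ => 0 ≤ ρ.im)]
        push_cast
        linarith
      · intro ρ hρ
        simp only [Finset.mem_filter, Set.Finite.mem_toFinset, not_le] at hρ
        obtain ⟨⟨h0, hre, h1, h2⟩, h3⟩ := hρ
        rw [abs_of_neg h3] at h1 h2
        exact ⟨h0, h3.ne, hball ρ _ h0 hre (abs_le.2 ⟨by linarith, by linarith⟩)⟩
    · intro ρ hρ
      simp only [Finset.mem_filter, Set.Finite.mem_toFinset] at hρ
      obtain ⟨⟨h0, hre, h1, h2⟩, h3⟩ := hρ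
      rw [abs_of_nonneg h3] at h1 h2
      exact ⟨h0, by linarith, hball ρ _ h0 hre (abs_le.2 ⟨by linarith, by linarith⟩)⟩
  · have h := hcard T T hT (le_abs_self T) (by rw [abs_of_pos] <;> linarith) ∅ (by simp)
    rw [Finset.card_empty, Nat.cast_zero] at h
    rw [hinf.ncard, Nat.cast_zero]
    linarith
end

section
/- Let N ≥ 2 and let 1 ≤ n_1 ≤ n_2 ≤ ⋯ ≤ n_J ≤ N be real numbers. For λ > 0 set χ(x, λ) = #{j : |x − n_j| ≤ λ}. Let a_1, …, a_J be complex numbers and S(it) = ∑_{j=1}^J a_j n_j^{−it}. Then there is an absolute constant C such that for all T_0 ∈ ℝ, T > 0 and η > 0, ∫_{T_0}^{T_0+T} |S(it)|² dt ≤ C (T + 1/η) ∑_{j=1}^J χ(n_j, ηN) |a_j|². -/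
open Filter

open MeasureTheory in
open scoped FourierTransform SchwartzMap in
/-- The Fourier transform turns a combination of translates into an exponential sum. -/
theorem fourier_sum_smul_compSubConst {ι : Type*} [Fintype ι] (g : 𝓢(ℝ, ℂ)) (a : ι → ℂ)
    (μ : ι → ℝ) (ξ : ℝ) :
    𝓕 (∑ j, a j • g.compSubConstCLM ℂ (μ j)) ξ =
      (∑ j, a j * Complex.exp (-(2 * Real.pi * μ j * ξ : ℝ) * Complex.I)) * 𝓕 g ξ := by
  have translate (m : ℝ) : 𝓕 (g.compSubConstCLM ℂ m) ξ =
      Complex.exp (-(2 * Real.pi * m * ξ : ℝ) * Complex.I) * 𝓕 g ξ := by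
    rw [SchwartzMap.fourier_coe, SchwartzMap.fourier_coe, Real.fourier_real_eq_integral_exp_smul,
      Real.fourier_real_eq_integral_exp_smul, ← integral_const_mul,
      ← integral_add_right_eq_self _ m]
    congr 1 with x
    simp only [SchwartzMap.compSubConstCLM_apply, add_sub_cancel_right, smul_eq_mul]
    rw [← mul_assoc, ← Complex.exp_add]
    congr 2
    push_cast
    ring
  have lin : 𝓕 (∑ j, a j • g.compSubConstCLM ℂ (μ j)) =
      ∑ j, a j • 𝓕 (g.compSubConstCLM ℂ (μ j)) := by
    simp only [← FourierTransform.fourierCLM_apply (R := ℂ), map_sum, map_smul]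
  rw [lin, sum_apply, Finset.sum_mul]
  exact Finset.sum_congr rfl fun j _ => by
    rw [smul_apply, translate, smul_eq_mul, ← mul_assoc]

/-- A sum of functions localized near the points `μ j` is controlled, in mean square, by the
number of points within distance `1` of each `μ j`. -/
theorem norm_sum_mul_localized_sq_le {ι : Type*} [Fintype ι] {g : ℝ → ℂ}
    (hg : ∀ x, ‖g x‖ ≤ 1) (hsupp : ∀ x, 1 / 2 < |x| → g x = 0) (a : ι → ℂ) (μ : ι → ℝ) (x : ℝ) :
    ‖∑ j, a j * g (x - μ j)‖ ^ 2 ≤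
      ∑ j, (Set.Icc (μ j - 1 / 2) (μ j + 1 / 2)).indicator (fun _ =>
        ((Finset.univ.filter fun i => |μ j - μ i| ≤ 1).card : ℝ) * ‖a j‖ ^ 2) x := by
  set s := Finset.univ.filter fun j => |x - μ j| ≤ 1 / 2 with hs
  have restrict : ∑ j, a j * g (x - μ j) = ∑ j ∈ s, a j * g (x - μ j) := by
    rw [hs, Finset.sum_filter]
    refine Finset.sum_congr rfl fun j _ => ?_
    split_ifs with h
    · rfl
    · rw [hsupp _ (not_le.mp h), mul_zero]
  have norm_le : ‖∑ j ∈ s, a j * g (x - μ j)‖ ≤ ∑ j ∈ s, ‖a j‖ := by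
    refine (norm_sum_le _ _).trans (Finset.sum_le_sum fun j _ => ?_)
    rw [norm_mul]
    exact mul_le_of_le_one_right (norm_nonneg _) (hg _)
  calc ‖∑ j, a j * g (x - μ j)‖ ^ 2
      ≤ (∑ j ∈ s, ‖a j‖) ^ 2 := by rw [restrict]; gcongr
    _ ≤ s.card * ∑ j ∈ s, ‖a j‖ ^ 2 := sq_sum_le_card_mul_sum_sq
    _ = ∑ j ∈ s, (s.card : ℝ) * ‖a j‖ ^ 2 := Finset.mul_sum _ _ _
    _ ≤ ∑ j ∈ s, ((Finset.univ.filter fun i => |μ j - μ i| ≤ 1).card : ℝ) * ‖a j‖ ^ 2 := by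
      refine Finset.sum_le_sum fun j hj => ?_
      gcongr
      intro i hi
      simp only [hs, Finset.mem_filter, Finset.mem_univ, true_and, abs_le] at hi hj ⊢
      constructor <;> linarith [hi.1, hi.2, hj.1, hj.2]
    _ = _ := by
      rw [hs, Finset.sum_filter]
      refine Finset.sum_congr rfl fun j _ => ?_
      rw [Set.indicator_apply]
      congr 1
      simp only [abs_le, Set.mem_Icc, eq_iff_iff]
      constructor <;> rintro ⟨h₁, h₂⟩ <;> constructor <;> linarith

open MeasureTheory in
open scoped FourierTransform SchwartzMap in
/-- There is a Schwartz function supported in `[-1/2, 1/2]` and bounded by `1` whose Fourier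
transform does not vanish at the origin. -/
theorem exists_schwartz_localized :
    ∃ g : 𝓢(ℝ, ℂ), (∀ x, ‖g x‖ ≤ 1) ∧ (∀ x, 1 / 2 < |x| → g x = 0) ∧ 𝓕 g 0 ≠ 0 := by
  let b : ContDiffBump (0 : ℝ) := ⟨1 / 4, 1 / 2, by norm_num, by norm_num⟩
  have hcs : HasCompactSupport fun x => (b x : ℂ) :=
    b.hasCompactSupport.comp_left (g := fun y : ℝ => (y : ℂ)) Complex.ofReal_zero
  have hcd : ContDiff ℝ (⊤ : ℕ∞) fun x => (b x : ℂ) := Complex.ofRealCLM.contDiff.comp b.contDiff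
  refine ⟨hcs.toSchwartzMap hcd, fun x => ?_, fun x hx => ?_, ?_⟩
  · change ‖(b x : ℂ)‖ ≤ 1
    rw [Complex.norm_real, Real.norm_of_nonneg b.nonneg]
    exact b.le_one
  · change (b x : ℂ) = 0
    rw [b.zero_of_le_dist (by simpa [b, Real.dist_eq] using hx.le), Complex.ofReal_zero]
  · rw [SchwartzMap.fourier_coe, Real.fourier_real_eq_integral_exp_smul]
    have h : ∫ x, (b x : ℂ) ≠ 0 := by
      rw [integral_complex_ofReal]
      exact_mod_cast b.integral_pos.ne'
    simpa using h

open MeasureTheory in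
open scoped FourierTransform SchwartzMap in
/-- Local mean value theorem for exponential sums, normalized to frequency scale `1`. -/
theorem exists_integral_norm_exp_sum_sq_le :
    ∃ C c : ℝ, 0 < C ∧ 0 < c ∧ 4 * Real.pi * c ≤ 1 ∧
      ∀ (J : ℕ) (μ : Fin J → ℝ) (a : Fin J → ℂ),
        (∫ t in -c..c, ‖∑ j, a j * Complex.exp (-(2 * Real.pi * μ j * t : ℝ) * Complex.I)‖ ^ 2) ≤
          C * ∑ j, ((Finset.univ.filter fun i => |μ j - μ i| ≤ 1).card : ℝ) * ‖a j‖ ^ 2 := by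
  obtain ⟨g, hg, hsupp, h0⟩ := exists_schwartz_localized
  set m := ‖𝓕 g 0‖ / 2 with hm
  have hm0 : 0 < m := by positivity
  have hnear : ∀ᶠ ξ in nhds (0 : ℝ), m < ‖𝓕 g ξ‖ :=
    (𝓕 g).continuous.norm.continuousAt.eventually_const_lt
      (by have := norm_pos_iff.mpr h0; rw [hm]; linarith)
  obtain ⟨ε, hε, hball⟩ := Metric.eventually_nhds_iff.mp hnear
  set c := min (ε / 2) (1 / (4 * Real.pi)) with hc
  have hc0 : 0 < c := by positivity
  have hcε : c < ε := (min_le_left _ _).trans_lt (by linarith)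
  refine ⟨1 / m ^ 2, c, by positivity, hc0, ?_, fun J μ a => ?_⟩
  · have := min_le_right (ε / 2) (1 / (4 * Real.pi))
    rwa [← hc, le_div_iff₀ (by positivity), mul_comm] at this
  set f : 𝓢(ℝ, ℂ) := ∑ j, a j • g.compSubConstCLM ℂ (μ j) with hf
  have f_apply (x : ℝ) : f x = ∑ j, a j * g (x - μ j) := by
    simp [hf]
  have sq_integrable (h : 𝓢(ℝ, ℂ)) : Integrable fun x => ‖h x‖ ^ 2 :=
    (memLp_two_iff_integrable_sq_norm h.continuous.aestronglyMeasurable).mp (h.memLp 2)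
  have physical : ∫ x, ‖f x‖ ^ 2 ≤
      ∑ j, ((Finset.univ.filter fun i => |μ j - μ i| ≤ 1).card : ℝ) * ‖a j‖ ^ 2 := by
    have hint (j : Fin J) : Integrable ((Set.Icc (μ j - 1 / 2) (μ j + 1 / 2)).indicator fun _ =>
        ((Finset.univ.filter fun i => |μ j - μ i| ≤ 1).card : ℝ) * ‖a j‖ ^ 2) :=
      (integrable_indicator_iff measurableSet_Icc).mpr (integrableOn_const (by simp))
    calc ∫ x, ‖f x‖ ^ 2
        ≤ ∫ x, ∑ j, (Set.Icc (μ j - 1 / 2) (μ j + 1 / 2)).indicator (fun _ =>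
          ((Finset.univ.filter fun i => |μ j - μ i| ≤ 1).card : ℝ) * ‖a j‖ ^ 2) x :=
          integral_mono (sq_integrable f) (integrable_finsetSum _ fun j _ => hint j) fun x => by
            simpa only [f_apply] using norm_sum_mul_localized_sq_le hg hsupp a μ x
      _ = _ := by
          rw [integral_finsetSum _ fun j _ => hint j]
          refine Finset.sum_congr rfl fun j _ => ?_
          rw [integral_indicator measurableSet_Icc, setIntegral_const, smul_eq_mul,
            Real.volume_real_Icc_of_le (by linarith)]
          ring
  have frequency : m ^ 2 * (∫ t in -c..c,
      ‖∑ j, a j * Complex.exp (-(2 * Real.pi * μ j * t : ℝ) * Complex.I)‖ ^ 2) ≤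
        ∫ ξ, ‖𝓕 f ξ‖ ^ 2 := by
    rw [← intervalIntegral.integral_const_mul]
    calc _ ≤ ∫ t in -c..c, ‖𝓕 f t‖ ^ 2 := by
          refine intervalIntegral.integral_mono_on (by linarith)
            (Continuous.intervalIntegrable (by fun_prop) _ _)
            (sq_integrable (𝓕 f)).intervalIntegrable fun t ht => ?_
          have hmt : m < ‖𝓕 g t‖ := hball <| by
            rw [Real.dist_eq, sub_zero]
            exact (abs_le.mpr ht).trans_lt hcε
          rw [hf, fourier_sum_smul_compSubConst, norm_mul, mul_pow, mul_comm]
          gcongr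
      _ ≤ ∫ ξ, ‖𝓕 f ξ‖ ^ 2 := by
          rw [intervalIntegral.integral_of_le (by linarith)]
          exact setIntegral_le_integral (sq_integrable (𝓕 f)) (.of_forall fun _ => by positivity)
  rw [one_div_mul_eq_div, le_div_iff₀ (by positivity), mul_comm]
  exact (frequency.trans_eq f.integral_norm_sq_fourier).trans physical

theorem abs_sub_le_mul_abs_log_sub {x y N : ℝ} (hx : 0 < x) (hy : 0 < y) (hxN : x ≤ N)
    (hyN : y ≤ N) : |x - y| ≤ N * |Real.log x - Real.log y| := by
  wlog h : y ≤ x generalizing x y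
  · rw [abs_sub_comm, abs_sub_comm (Real.log x)]
    exact this hy hx hyN hxN (le_of_not_ge h)
  have hlog : 0 ≤ Real.log x - Real.log y := sub_nonneg.mpr (Real.log_le_log hy h)
  have key := Real.log_le_sub_one_of_pos (div_pos hy hx)
  rw [Real.log_div hy.ne' hx.ne'] at key
  rw [abs_of_nonneg (sub_nonneg.mpr h), abs_of_nonneg hlog]
  calc x - y = x * (1 - y / x) := by field_simp
    _ ≤ x * (Real.log x - Real.log y) := mul_le_mul_of_nonneg_left (by linarith) hx.le
    _ ≤ N * (Real.log x - Real.log y) := by gcongr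

/-- Theorem 2.1: mean value theorem for general Dirichlet polynomials.
`χ(x, λ) = #{j : |x - n_j| ≤ λ}` counts the local clusters of frequencies. -/
theorem mvt_dirichlet_polynomials :
    ∃ C : ℝ, 0 < C ∧
      ∀ (N : ℝ) (J : ℕ) (n : Fin J → ℝ) (a : Fin J → ℂ),
        2 ≤ N → Monotone n → (∀ j, 1 ≤ n j) → (∀ j, n j ≤ N) →
        ∀ (T₀ T η : ℝ), 0 < T → 0 < η →
          (∫ t in T₀..T₀ + T, ‖∑ j, a j * (n j : ℂ) ^ (-(Complex.I * (t : ℂ)))‖ ^ 2) ≤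
            C * (T + 1 / η) *
              ∑ j, ((Finset.univ.filter fun i => |n j - n i| ≤ η * N).card : ℝ)
                * ‖a j‖ ^ 2 := by
  obtain ⟨C, c, hC, hc, hcπ, hlocal⟩ := exists_integral_norm_exp_sum_sq_le
  refine ⟨C / (2 * c), by positivity, fun N J n a hN _ hn1 hnN T₀ T η hT hη => ?_⟩
  have hn0 (j : Fin J) : 0 < n j := one_pos.trans_le (hn1 j)
  set R := T + 1 / η with hR
  have hR0 : 0 < R := by positivity
  have hηR : 1 ≤ η * R := by
    have : η * R = η * T + 1 := by rw [hR]; field_simp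
    nlinarith [mul_pos hη hT]
  set k := R / (2 * c) with hk
  have hk0 : 0 < k := by positivity
  set M := T₀ + R / 2 with hM
  set μ : Fin J → ℝ := fun j => Real.log (n j) * k / (2 * Real.pi) with hμ
  set b : Fin J → ℂ := fun j => a j * Complex.exp (-(Real.log (n j) * M : ℝ) * Complex.I) with hb
  set S : ℝ → ℝ := fun t => ‖∑ j, a j * (n j : ℂ) ^ (-(Complex.I * (t : ℂ)))‖ ^ 2 with hS
  have cpow_eq (j : Fin J) (t : ℝ) : (n j : ℂ) ^ (-(Complex.I * (t : ℂ))) =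
      Complex.exp (-(Real.log (n j) * t : ℝ) * Complex.I) := by
    rw [Complex.cpow_def_of_ne_zero (by exact_mod_cast (hn0 j).ne'),
      ← Complex.ofReal_log (hn0 j).le]
    congr 1
    push_cast
    ring
  have S_cont : Continuous S := by
    simp only [hS, cpow_eq]
    fun_prop
  have norm_b (j : Fin J) : ‖b j‖ = ‖a j‖ := by
    rw [hb, norm_mul, ← Complex.ofReal_neg, Complex.norm_exp_ofReal_mul_I, mul_one]
  have S_rescale (u : ℝ) : S (k * u + M) =
      ‖∑ j, b j * Complex.exp (-(2 * Real.pi * μ j * u : ℝ) * Complex.I)‖ ^ 2 := by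
    simp only [hS, cpow_eq, hb, mul_assoc, ← Complex.exp_add]
    congr 2
    refine Finset.sum_congr rfl fun j _ => ?_
    congr 2
    have : 2 * (Real.pi * (μ j * u)) = Real.log (n j) * (k * u) := by
      simp only [hμ]
      field_simp
    rw [this]
    push_cast
    ring
  have close (i j : Fin J) (h : |μ j - μ i| ≤ 1) : |n j - n i| ≤ η * N := by
    have hdiff : |μ j - μ i| = |Real.log (n j) - Real.log (n i)| * (k / (2 * Real.pi)) := by
      rw [← abs_of_pos (show 0 < k / (2 * Real.pi) by positivity), ← abs_mul]
      simp only [hμ]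
      congr 1
      ring
    have hscale : 1 ≤ η * (k / (2 * Real.pi)) := by
      have : η * (k / (2 * Real.pi)) = η * R / (4 * Real.pi * c) := by
        rw [hk]; field_simp; ring
      rw [this, le_div_iff₀ (by positivity)]
      linarith
    have hlog : |Real.log (n j) - Real.log (n i)| ≤ η := by
      refine le_of_mul_le_mul_right (a := k / (2 * Real.pi)) ?_ (by positivity)
      linarith
    calc |n j - n i| ≤ N * |Real.log (n j) - Real.log (n i)| :=
          abs_sub_le_mul_abs_log_sub (hn0 j) (hn0 i) (hnN j) (hnN i)
      _ ≤ N * η := by gcongr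
      _ = η * N := mul_comm _ _
  calc ∫ t in T₀..T₀ + T, S t
      ≤ ∫ t in T₀..T₀ + R, S t := by
        refine intervalIntegral.integral_mono_interval le_rfl (by linarith) ?_
          (.of_forall fun t => by positivity) (S_cont.intervalIntegrable _ _)
        have : 0 < 1 / η := by positivity
        linarith
    _ = k * ∫ u in -c..c, S (k * u + M) := by
        rw [intervalIntegral.mul_integral_comp_mul_add]
        congr 1 <;> rw [hk, hM] <;> field_simp <;> ring
    _ ≤ k * (C * ∑ j, ((Finset.univ.filter fun i => |μ j - μ i| ≤ 1).card : ℝ) * ‖b j‖ ^ 2) := by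
        simp only [S_rescale]
        gcongr
        exact hlocal J μ b
    _ ≤ k * (C * ∑ j, ((Finset.univ.filter fun i => |n j - n i| ≤ η * N).card : ℝ)
          * ‖a j‖ ^ 2) := by
        simp only [norm_b]
        gcongr k * (C * ∑ j, (Nat.cast (Finset.card ?_)) * _) with j _
        exact Finset.monotone_filter_right _ fun i _ h => close i j h
    _ = _ := by rw [hk]; ring
end

section
/- Let α > 0, δ > 0, T_0 ∈ ℝ, T > 0, and let 𝒮 be a finite set of complex numbers s = σ + it with σ ≥ α and T_0 + δ/2 ≤ t ≤ T_0 + T − δ/2, such that distinct elements of 𝒮 have imaginary parts differing by at least δ. Let N ≥ 2, let N ≤ n_1 ≤ ⋯ ≤ n_J ≤ 2N be real numbers, χ(x, λ) = #{j : |x − n_j| ≤ λ}, a_1, …, a_J complex, and S(s) = ∑_{j=1}^J a_j n_j^{−s}. Then there is an absolute constant C such that for every η > 0, ∑_{s∈𝒮} |S(s)|² ≤ C (T + 1/η)(log N + 1/δ) ∑_{j=1}^J χ(n_j, ηN) |a_j|² / N^{2α}. -/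
open Filter

open MeasureTheory

/-- The generalized Dirichlet polynomial `∑ b_j e^{-l_j s}` with real frequencies `l_j`. -/
noncomputable def expPoly {ι : Type*} [Fintype ι] (b : ι → ℂ) (l : ι → ℝ) (s : ℂ) : ℂ :=
  ∑ j, b j * Complex.exp (-(l j : ℂ) * s)

section

variable {ι : Type*} [Fintype ι]

lemma sum_div_card_fiber_le_tsum (m : ι → ℤ) (h : ℤ → ℝ) (hs : Summable h) (h0 : ∀ k, 0 ≤ h k) :
    ∑ j, h (m j) / ((Finset.univ.filter fun i => m i = m j).card : ℝ) ≤ ∑' k, h k := by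
  classical
  rw [Finset.sum_comp (s := Finset.univ)
    (fun k => h k / ((Finset.univ.filter fun i => m i = k).card : ℝ)) m]
  refine le_trans (Finset.sum_le_sum fun k hk => ?_)
    (hs.sum_le_tsum (Finset.univ.image m) fun k _ => h0 k)
  rw [nsmul_eq_mul]
  obtain ⟨j, -, rfl⟩ := Finset.mem_image.mp hk
  have : 0 < ((Finset.univ.filter fun i => m i = m j).card : ℝ) := by
    exact_mod_cast Finset.card_pos.mpr ⟨j, by simp⟩
  exact (mul_div_cancel₀ _ this.ne').le

/-- Schur's test for a kernel depending only on the difference of integer labels. -/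
lemma sum_mul_mul_kernel_le (m : ι → ℤ) (g : ℤ → ℝ) (hs : Summable g) (h0 : ∀ k, 0 ≤ g k)
    (heven : ∀ k, g (-k) = g k) (x : ι → ℝ) :
    ∑ i, ∑ j, x i * x j * g (m i - m j) ≤
      (∑' k, g k) * ∑ j, ((Finset.univ.filter fun i => m i = m j).card : ℝ) * x j ^ 2 := by
  classical
  set c : ι → ℝ := fun j => ((Finset.univ.filter fun i => m i = m j).card : ℝ) with hc
  have hcpos : ∀ j, 0 < c j := fun j => by
    simp only [hc]
    exact_mod_cast Finset.card_pos.mpr ⟨j, by simp⟩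
  have amgm : ∀ i j, x i * x j * g (m i - m j) ≤
      (c i * x i ^ 2) * (g (m i - m j) / c j) / 2 + (c j * x j ^ 2) * (g (m j - m i) / c i) / 2 := by
    intro i j
    have hg : g (m j - m i) = g (m i - m j) := by rw [← heven, neg_sub]
    have key : x i * x j ≤ c i * x i ^ 2 / c j / 2 + c j * x j ^ 2 / c i / 2 := by
      have hi := hcpos i
      have hj := hcpos j
      have : c i * x i ^ 2 / c j / 2 + c j * x j ^ 2 / c i / 2 - x i * x j
          = (c i * x i - c j * x j) ^ 2 / (2 * c i * c j) := by
        field_simp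
        ring
      have h2 : 0 ≤ (c i * x i - c j * x j) ^ 2 / (2 * c i * c j) := by positivity
      linarith
    calc x i * x j * g (m i - m j)
        ≤ (c i * x i ^ 2 / c j / 2 + c j * x j ^ 2 / c i / 2) * g (m i - m j) :=
          mul_le_mul_of_nonneg_right key (h0 _)
      _ = _ := by rw [hg]; ring
  have half : ∑ i, ∑ j, (c i * x i ^ 2) * (g (m i - m j) / c j) / 2 ≤
      (∑' k, g k) * (∑ j, c j * x j ^ 2) / 2 := by
    rw [mul_comm (∑' k, g k), Finset.sum_mul, Finset.sum_div]
    refine Finset.sum_le_sum fun i _ => ?_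
    rw [← Finset.sum_div, ← Finset.mul_sum]
    have hinj : Function.Injective fun k : ℤ => m i - k := sub_right_injective
    have hsum : ∑' k, g (m i - k) = ∑' k, g k := (Equiv.subLeft (m i)).tsum_eq g
    have := sum_div_card_fiber_le_tsum m (fun k => g (m i - k)) (hs.comp_injective hinj) fun k => h0 _
    rw [hsum] at this
    have h3 : 0 ≤ c i * x i ^ 2 := mul_nonneg (hcpos i).le (sq_nonneg _)
    gcongr
  calc ∑ i, ∑ j, x i * x j * g (m i - m j)
      ≤ ∑ i, ∑ j, ((c i * x i ^ 2) * (g (m i - m j) / c j) / 2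
          + (c j * x j ^ 2) * (g (m j - m i) / c i) / 2) :=
        Finset.sum_le_sum fun i _ => Finset.sum_le_sum fun j _ => amgm i j
    _ = (∑ i, ∑ j, (c i * x i ^ 2) * (g (m i - m j) / c j) / 2)
          + ∑ i, ∑ j, (c i * x i ^ 2) * (g (m i - m j) / c j) / 2 := by
        simp_rw [Finset.sum_add_distrib]
        congr 1
        exact Finset.sum_comm
    _ ≤ _ := by linarith

lemma summable_one_div_one_add_int_sq : Summable fun k : ℤ => 32 / (1 + (k : ℝ) ^ 2) := by
  have h := (Real.summable_one_div_int_add_rpow (1 / 2) 2).mpr (by norm_num)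
  refine Summable.of_nonneg_of_le (fun k => by positivity) (fun k => ?_) (h.mul_left 64)
  rw [show (2 : ℝ) = ((2 : ℕ) : ℝ) by norm_num, Real.rpow_natCast, sq_abs, mul_one_div]
  have hk : ((k : ℝ) + 1 / (2 : ℕ)) ≠ 0 := by
    intro h
    have : (2 * k + 1 : ℝ) = 0 := by push_cast at h; linarith
    have : 2 * k + 1 = 0 := by exact_mod_cast this
    omega
  have hk2 : 0 < ((k : ℝ) + 1 / (2 : ℕ)) ^ 2 := by positivity
  rw [div_le_div_iff₀ (by positivity) hk2]
  push_cast
  nlinarith [sq_nonneg ((k : ℝ) - 1 / 2)]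

lemma continuous_expPoly (b : ι → ℂ) (l : ι → ℝ) : Continuous (expPoly b l) := by
  unfold expPoly
  fun_prop

lemma integral_gaussian_mul_norm_expPoly_sq_le (b : ι → ℂ) (l : ι → ℝ) {β : ℝ} (hβ : 0 < β) :
    Integrable (fun t : ℝ => Real.exp (-β * t ^ 2) * ‖expPoly b l (Complex.I * t)‖ ^ 2) ∧
    ∫ t : ℝ, Real.exp (-β * t ^ 2) * ‖expPoly b l (Complex.I * t)‖ ^ 2 ≤
      √(Real.pi / β) * ∑ i, ∑ j, ‖b i‖ * ‖b j‖ * Real.exp (-(l i - l j) ^ 2 / (4 * β)) := by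
  have hre : 0 < (β : ℂ).re := by simpa using hβ
  set G : ι → ι → ℝ → ℂ := fun i j t => Complex.exp (Complex.I * ((l j - l i : ℝ) : ℂ) * t)
    * Complex.exp (-(β : ℂ) * (t : ℂ) ^ 2) with hG
  have hinteg : ∀ i j, Integrable (G i j) := by
    intro i j
    refine (integrable_cexp_quadratic hre (Complex.I * ((l j - l i : ℝ) : ℂ)) 0).congr ?_
    refine Eventually.of_forall fun t => ?_
    simp only [hG]
    rw [← Complex.exp_add]
    congr 1
    ring
  have hexp : ∀ t : ℝ, ((Real.exp (-β * t ^ 2) * ‖expPoly b l (Complex.I * t)‖ ^ 2 : ℝ) : ℂ)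
      = ∑ i, ∑ j, b i * (starRingEnd ℂ) (b j) * G i j t := by
    intro t
    push_cast
    rw [← Complex.mul_conj']
    simp only [expPoly, map_sum, map_mul, ← Complex.exp_conj]
    rw [Finset.sum_mul_sum, Finset.mul_sum]
    refine Finset.sum_congr rfl fun i _ => ?_
    rw [Finset.mul_sum]
    refine Finset.sum_congr rfl fun j _ => ?_
    simp only [hG, map_neg, Complex.conj_ofReal, Complex.conj_I]
    have : Complex.exp (Complex.I * ((l j - l i : ℝ) : ℂ) * t) =
        Complex.exp (-(l i : ℂ) * (Complex.I * t)) * Complex.exp (-(l j : ℂ) * (-Complex.I * t)) := by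
      rw [← Complex.exp_add]
      congr 1
      push_cast
      ring
    rw [this]
    ring
  have hintS : Integrable fun t : ℝ => ∑ i, ∑ j, b i * (starRingEnd ℂ) (b j) * G i j t :=
    integrable_finsetSum _ fun i _ => integrable_finsetSum _ fun j _ => (hinteg i j).const_mul _
  constructor
  · have := hintS.re
    refine this.congr (Eventually.of_forall fun t => ?_)
    simp only [← hexp t]
    exact Complex.ofReal_re _
  · have h1 : ((∫ t : ℝ, Real.exp (-β * t ^ 2) * ‖expPoly b l (Complex.I * t)‖ ^ 2 : ℝ) : ℂ)
        = ∑ i, ∑ j, b i * (starRingEnd ℂ) (b j) * ∫ t, G i j t := by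
      rw [← integral_complex_ofReal]
      simp_rw [hexp]
      rw [integral_finsetSum _ fun i _ => integrable_finsetSum _ fun j _ => (hinteg i j).const_mul _]
      refine Finset.sum_congr rfl fun i _ => ?_
      rw [integral_finsetSum _ fun j _ => (hinteg i j).const_mul _]
      refine Finset.sum_congr rfl fun j _ => ?_
      rw [integral_const_mul]
    have hnorm : ∀ i j, ‖∫ t, G i j t‖ = √(Real.pi / β) * Real.exp (-(l i - l j) ^ 2 / (4 * β)) := by
      intro i j
      simp only [hG]
      rw [fourierIntegral_gaussian hre, norm_mul, Complex.norm_exp, ← Complex.ofReal_div,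
        Complex.norm_cpow_eq_rpow_re_of_pos (by positivity), Real.sqrt_eq_rpow]
      congr 2
      · norm_num
      · have : (-((l j - l i : ℝ) : ℂ) ^ 2 / (4 * (β : ℂ))) =
            ((-(l i - l j) ^ 2 / (4 * β) : ℝ) : ℂ) := by
          push_cast
          ring
        rw [this, Complex.ofReal_re]
    calc _ ≤ ‖((∫ t : ℝ, Real.exp (-β * t ^ 2) * ‖expPoly b l (Complex.I * t)‖ ^ 2 : ℝ) : ℂ)‖ := by
          rw [Complex.norm_real]
          exact Real.le_norm_self _
      _ ≤ ∑ i, ∑ j, ‖b i * (starRingEnd ℂ) (b j) * ∫ t, G i j t‖ := by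
          rw [h1]
          exact (norm_sum_le _ _).trans (Finset.sum_le_sum fun i _ => norm_sum_le _ _)
      _ = _ := by
          rw [Finset.mul_sum]
          refine Finset.sum_congr rfl fun i _ => ?_
          rw [Finset.mul_sum]
          refine Finset.sum_congr rfl fun j _ => ?_
          rw [norm_mul, norm_mul, hnorm, RCLike.norm_conj]
          ring

lemma exp_neg_sq_div_four_le (x : ℝ) (k : ℤ) (hk : |(k : ℝ)| ≤ 2 * |x| + 1) :
    Real.exp (-x ^ 2 / 4) ≤ 32 / (1 + (k : ℝ) ^ 2) := by
  have h1 : (k : ℝ) ^ 2 ≤ 8 * x ^ 2 + 2 := by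
    rw [← sq_abs, ← sq_abs x]
    nlinarith [abs_nonneg (k : ℝ), abs_nonneg x, sq_nonneg (2 * |x| - 1)]
  have h2 := Real.add_one_le_exp (x ^ 2 / 4)
  rw [neg_div, Real.exp_neg, inv_eq_one_div, div_le_div_iff₀ (Real.exp_pos _) (by positivity)]
  nlinarith

/-- The absolute constant in the mean value theorem for generalized Dirichlet polynomials. -/
noncomputable def meanValueConst : ℝ :=
  Real.exp 1 * √Real.pi * ∑' k : ℤ, 32 / (1 + (k : ℝ) ^ 2)

lemma meanValueConst_pos : 0 < meanValueConst := by
  have := summable_one_div_one_add_int_sq.tsum_pos (fun k => by positivity) 0 (by norm_num)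
  unfold meanValueConst
  positivity

/-- Mean value theorem on an interval starting at the origin. -/
lemma integral_Ioc_zero_norm_expPoly_sq_le (b : ι → ℂ) (l : ι → ℝ) {T η : ℝ} (hT : 0 < T) (hη : 0 < η) :
    ∫ t in Set.Ioc 0 T, ‖expPoly b l (Complex.I * t)‖ ^ 2 ≤ meanValueConst * (T + 1 / η) *
      ∑ j, ((Finset.univ.filter fun i => |l j - l i| ≤ η / 2).card : ℝ) * ‖b j‖ ^ 2 := by
  set A : ℝ := T + 1 / η with hA
  have hη' : 0 < 1 / η := by positivity
  have hApos : 0 < A := by positivity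
  set β : ℝ := (A ^ 2)⁻¹ with hβdef
  have hβ : 0 < β := by positivity
  obtain ⟨hinteg, hle⟩ := integral_gaussian_mul_norm_expPoly_sq_le b l hβ
  have hcont := continuous_expPoly b l
  have hpt : ∀ t ∈ Set.Ioc 0 T, ‖expPoly b l (Complex.I * t)‖ ^ 2 ≤
      Real.exp 1 * (Real.exp (-β * t ^ 2) * ‖expPoly b l (Complex.I * t)‖ ^ 2) := by
    intro t ht
    rw [← mul_assoc, ← Real.exp_add]
    refine le_mul_of_one_le_left (sq_nonneg _) (Real.one_le_exp ?_)
    have htA : t ≤ A := by linarith [ht.2]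
    have : β * t ^ 2 ≤ 1 := by
      rw [hβdef, inv_mul_le_iff₀ (by positivity), mul_one]
      exact pow_le_pow_left₀ ht.1.le htA 2
    linarith
  have hstep1 : ∫ t in Set.Ioc 0 T, ‖expPoly b l (Complex.I * t)‖ ^ 2 ≤
      Real.exp 1 * ∫ t : ℝ, Real.exp (-β * t ^ 2) * ‖expPoly b l (Complex.I * t)‖ ^ 2 := by
    rw [← integral_const_mul]
    refine le_trans (setIntegral_mono_on ?_ (hinteg.const_mul _).integrableOn measurableSet_Ioc hpt)
      (setIntegral_le_integral (hinteg.const_mul _) (Eventually.of_forall fun t => by positivity))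
    exact (Continuous.integrableOn_Icc (by fun_prop)).mono_set Set.Ioc_subset_Icc_self
  set m : ι → ℤ := fun i => ⌊2 * A * l i⌋ with hm
  have hker : ∀ i j, Real.exp (-(l i - l j) ^ 2 / (4 * β)) ≤
      32 / (1 + ((m i - m j : ℤ) : ℝ) ^ 2) := by
    intro i j
    have h := exp_neg_sq_div_four_le (A * (l i - l j)) (m i - m j) ?_
    · convert h using 2
      rw [hβdef]
      field_simp
    · have h1 := Int.floor_le (2 * A * l i)
      have h2 := Int.lt_floor_add_one (2 * A * l i)
      have h3 := Int.floor_le (2 * A * l j)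
      have h4 := Int.lt_floor_add_one (2 * A * l j)
      have h5 := le_abs_self (A * (l i - l j))
      have h6 := neg_abs_le (A * (l i - l j))
      push_cast
      simp only [hm]
      rw [abs_le]
      constructor <;> linarith
  have hcard : ∀ j, ((Finset.univ.filter fun i => m i = m j).card : ℝ) ≤
      ((Finset.univ.filter fun i => |l j - l i| ≤ η / 2).card : ℝ) := by
    intro j
    refine Nat.cast_le.mpr (Finset.card_le_card fun i hi => ?_)
    simp only [Finset.mem_filter, Finset.mem_univ, true_and] at hi ⊢
    have h := Int.abs_sub_lt_one_of_floor_eq_floor (by simpa only [hm] using hi.symm)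
    have hAη : 1 ≤ A * η := by
      rw [hA, add_mul, one_div_mul_cancel hη.ne']
      nlinarith
    rw [← mul_sub, abs_mul, abs_of_pos (by positivity)] at h
    nlinarith [abs_nonneg (l j - l i)]
  have hschur := sum_mul_mul_kernel_le m (fun k => 32 / (1 + (k : ℝ) ^ 2))
    summable_one_div_one_add_int_sq (fun k => by positivity) (fun k => by simp) fun i => ‖b i‖
  have hsqrt : √(Real.pi / β) = √Real.pi * A := by
    rw [hβdef, div_inv_eq_mul, Real.sqrt_mul Real.pi_pos.le, Real.sqrt_sq hApos.le]
  have htsum : 0 ≤ ∑' k : ℤ, 32 / (1 + (k : ℝ) ^ 2) := tsum_nonneg fun k => by positivity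
  calc _ ≤ _ := hstep1
    _ ≤ Real.exp 1 * (√(Real.pi / β) * ∑ i, ∑ j, ‖b i‖ * ‖b j‖ *
          (32 / (1 + ((m i - m j : ℤ) : ℝ) ^ 2))) := by
        refine mul_le_mul_of_nonneg_left (hle.trans ?_) (Real.exp_pos _).le
        gcongr with i _ j _
        exact hker i j
    _ ≤ Real.exp 1 * (√(Real.pi / β) * ((∑' k : ℤ, 32 / (1 + (k : ℝ) ^ 2)) *
          ∑ j, ((Finset.univ.filter fun i => |l j - l i| ≤ η / 2).card : ℝ) * ‖b j‖ ^ 2)) := by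
        gcongr
        refine hschur.trans ?_
        exact mul_le_mul_of_nonneg_left (Finset.sum_le_sum fun j _ =>
          mul_le_mul_of_nonneg_right (hcard j) (sq_nonneg _)) htsum
    _ = _ := by
        rw [hsqrt, meanValueConst]
        ring

/-- Mean value theorem for generalized Dirichlet polynomials on a vertical segment. -/
lemma integral_norm_expPoly_sq_le (b : ι → ℂ) (l : ι → ℝ) (T₀ : ℝ) {T η : ℝ} (hT : 0 < T)
    (hη : 0 < η) :
    ∫ t in Set.Ioc T₀ (T₀ + T), ‖expPoly b l (Complex.I * t)‖ ^ 2 ≤ meanValueConst * (T + 1 / η) *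
      ∑ j, ((Finset.univ.filter fun i => |l j - l i| ≤ η / 2).card : ℝ) * ‖b j‖ ^ 2 := by
  have h := integral_Ioc_zero_norm_expPoly_sq_le
    (fun j => b j * Complex.exp (-(l j : ℂ) * (Complex.I * T₀))) l hT hη
  have hn : ∀ j, ‖b j * Complex.exp (-(l j : ℂ) * (Complex.I * T₀))‖ = ‖b j‖ := by
    intro j
    rw [norm_mul, Complex.norm_exp]
    simp
  have hs : ∀ t : ℝ, expPoly (fun j => b j * Complex.exp (-(l j : ℂ) * (Complex.I * T₀))) l
      (Complex.I * t) = expPoly b l (Complex.I * ((t + T₀ : ℝ) : ℂ)) := by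
    intro t
    unfold expPoly
    refine Finset.sum_congr rfl fun j _ => ?_
    rw [mul_assoc, ← Complex.exp_add]
    congr 2
    push_cast
    ring
  simp only [hn, hs] at h
  rw [← intervalIntegral.integral_of_le (by linarith)] at h ⊢
  rw [intervalIntegral.integral_comp_add_right
    (fun t : ℝ => ‖expPoly b l (Complex.I * t)‖ ^ 2) T₀, zero_add, add_comm T T₀] at h
  exact h

end

section

variable {f f' : ℝ → ℂ}

lemma norm_sq_le_norm_sq_add_integral (hf : ∀ x, HasDerivAt f (f' x) x) (hf' : Continuous f')
    {L : ℝ} (hL : 0 < L) {p q x y : ℝ} (hx : x ∈ Set.Icc p q) (hy : y ∈ Set.Icc p q) :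
    ‖f x‖ ^ 2 ≤ ‖f y‖ ^ 2 + ∫ t in Set.Ioc p q, (L * ‖f t‖ ^ 2 + ‖f' t‖ ^ 2 / L) := by
  have hfc : Continuous f := continuous_iff_continuousAt.mpr fun x => (hf x).continuousAt
  have hD : Continuous fun t => 2 * inner ℝ (f t) (f' t) := by fun_prop
  have hinteg : IntegrableOn (fun t => L * ‖f t‖ ^ 2 + ‖f' t‖ ^ 2 / L) (Set.Ioc p q) :=
    (Continuous.integrableOn_Icc (by fun_prop)).mono_set Set.Ioc_subset_Icc_self
  have hsub : Set.uIoc y x ⊆ Set.Ioc p q :=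
    Set.Ioc_subset_Ioc (le_min hy.1 hx.1) (max_le hy.2 hx.2)
  have hftc : ∫ t in y..x, 2 * inner ℝ (f t) (f' t) = ‖f x‖ ^ 2 - ‖f y‖ ^ 2 :=
    intervalIntegral.integral_eq_sub_of_hasDerivAt (f := fun t => ‖f t‖ ^ 2)
      (fun t _ => (hf t).norm_sq) (hD.intervalIntegrable _ _)
  have h1 : ‖f x‖ ^ 2 - ‖f y‖ ^ 2 ≤ ∫ t in Set.uIoc y x, ‖2 * inner ℝ (f t) (f' t)‖ := by
    rw [← hftc]
    exact (Real.le_norm_self _).trans intervalIntegral.norm_integral_le_integral_norm_uIoc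
  have h2 : ∫ t in Set.uIoc y x, ‖2 * inner ℝ (f t) (f' t)‖ ≤
      ∫ t in Set.uIoc y x, (L * ‖f t‖ ^ 2 + ‖f' t‖ ^ 2 / L) := by
    refine setIntegral_mono_on ?_ (hinteg.mono_set hsub) measurableSet_uIoc fun t _ => ?_
    · exact (hD.norm.integrableOn_Icc (a := p) (b := q)).mono_set
        (hsub.trans Set.Ioc_subset_Icc_self)
    · rw [norm_mul, Real.norm_ofNat]
      have hcs := norm_inner_le_norm (𝕜 := ℝ) (f t) (f' t)
      have hsq : L * ‖f t‖ ^ 2 + ‖f' t‖ ^ 2 / L - 2 * (‖f t‖ * ‖f' t‖) =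
          (L * ‖f t‖ - ‖f' t‖) ^ 2 / L := by
        field_simp
        ring
      have : 0 ≤ (L * ‖f t‖ - ‖f' t‖) ^ 2 / L := by positivity
      linarith
  have h3 : ∫ t in Set.uIoc y x, (L * ‖f t‖ ^ 2 + ‖f' t‖ ^ 2 / L) ≤
      ∫ t in Set.Ioc p q, (L * ‖f t‖ ^ 2 + ‖f' t‖ ^ 2 / L) :=
    setIntegral_mono_set hinteg (Eventually.of_forall fun t => by dsimp; positivity) hsub.eventuallyLE
  linarith

/-- A form of Gallagher's (Sobolev) inequality. -/
lemma norm_sq_le_integral_Ioc (hf : ∀ x, HasDerivAt f (f' x) x) (hf' : Continuous f')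
    {L δ : ℝ} (hL : 0 < L) (hδ : 0 < δ) (t : ℝ) :
    ‖f t‖ ^ 2 ≤ ∫ u in Set.Ioc (t - δ / 2) (t + δ / 2),
      ((1 / δ + L) * ‖f u‖ ^ 2 + ‖f' u‖ ^ 2 / L) := by
  have hfc : Continuous f := continuous_iff_continuousAt.mpr fun x => (hf x).continuousAt
  have hinteg : ∀ g : ℝ → ℝ, Continuous g → IntegrableOn g (Set.Ioc (t - δ / 2) (t + δ / 2)) :=
    fun g hg => hg.integrableOn_Icc.mono_set Set.Ioc_subset_Icc_self
  set R := ∫ u in Set.Ioc (t - δ / 2) (t + δ / 2), (L * ‖f u‖ ^ 2 + ‖f' u‖ ^ 2 / L) with hR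
  have hmono : ∫ _ in Set.Ioc (t - δ / 2) (t + δ / 2), (‖f t‖ ^ 2 - R) ≤
      ∫ u in Set.Ioc (t - δ / 2) (t + δ / 2), ‖f u‖ ^ 2 := by
    refine setIntegral_mono_on (hinteg _ continuous_const) (hinteg _ (by fun_prop)) measurableSet_Ioc
      fun u hu => ?_
    have := norm_sq_le_norm_sq_add_integral hf hf' hL (p := t - δ / 2) (q := t + δ / 2) (x := t)
      (y := u) ⟨by linarith, by linarith⟩ (Set.Ioc_subset_Icc_self hu)
    linarith
  rw [setIntegral_const, measureReal_def, Real.volume_Ioc, ENNReal.toReal_ofReal (by linarith),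
    smul_eq_mul, show t + δ / 2 - (t - δ / 2) = δ by ring] at hmono
  have hsplit : ∫ u in Set.Ioc (t - δ / 2) (t + δ / 2), ((1 / δ + L) * ‖f u‖ ^ 2 + ‖f' u‖ ^ 2 / L)
      = 1 / δ * (∫ u in Set.Ioc (t - δ / 2) (t + δ / 2), ‖f u‖ ^ 2) + R := by
    rw [hR, ← integral_const_mul, ← integral_add (hinteg _ (by fun_prop)) (hinteg _ (by fun_prop))]
    congr 1
    ext u
    ring
  rw [hsplit]
  have : ‖f t‖ ^ 2 - R ≤ 1 / δ * ∫ u in Set.Ioc (t - δ / 2) (t + δ / 2), ‖f u‖ ^ 2 := by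
    rw [one_div, ← div_eq_inv_mul, le_div_iff₀' hδ]
    exact hmono
  linarith

/-- Gallagher's inequality summed over well-spaced points. -/
lemma sum_norm_sq_le_integral (hf : ∀ x, HasDerivAt f (f' x) x) (hf' : Continuous f')
    {L δ T₀ T : ℝ} (hL : 0 < L) (hδ : 0 < δ) {κ : Type*} (𝒮 : Finset κ) (τ : κ → ℝ)
    (hτ : ∀ s ∈ 𝒮, T₀ + δ / 2 ≤ τ s ∧ τ s ≤ T₀ + T - δ / 2)
    (hsep : ∀ s ∈ 𝒮, ∀ s' ∈ 𝒮, s ≠ s' → δ ≤ |τ s - τ s'|) :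
    ∑ s ∈ 𝒮, ‖f (τ s)‖ ^ 2 ≤ (1 / δ + L) * (∫ u in Set.Ioc T₀ (T₀ + T), ‖f u‖ ^ 2) +
      (∫ u in Set.Ioc T₀ (T₀ + T), ‖f' u‖ ^ 2) / L := by
  have hfc : Continuous f := continuous_iff_continuousAt.mpr fun x => (hf x).continuousAt
  have hinteg : ∀ (g : ℝ → ℝ) (p q : ℝ), Continuous g → IntegrableOn g (Set.Ioc p q) :=
    fun g p q hg => hg.integrableOn_Icc.mono_set Set.Ioc_subset_Icc_self
  have hF : Continuous fun u => (1 / δ + L) * ‖f u‖ ^ 2 + ‖f' u‖ ^ 2 / L := by fun_prop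
  have hdisj : (𝒮 : Set κ).Pairwise
      (Function.onFun Disjoint fun s => Set.Ioc (τ s - δ / 2) (τ s + δ / 2)) := by
    intro s hs s' hs' hne
    rw [Function.onFun, Set.disjoint_left]
    intro u hu hu'
    have h := hsep s hs s' hs' hne
    have : |τ s - τ s'| < δ := by
      rw [abs_lt]
      constructor <;> linarith [hu.1, hu.2, hu'.1, hu'.2]
    linarith
  have hsub : (⋃ s ∈ 𝒮, Set.Ioc (τ s - δ / 2) (τ s + δ / 2)) ⊆ Set.Ioc T₀ (T₀ + T) :=
    Set.iUnion₂_subset fun s hs => Set.Ioc_subset_Ioc (by linarith [(hτ s hs).1])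
      (by linarith [(hτ s hs).2])
  calc ∑ s ∈ 𝒮, ‖f (τ s)‖ ^ 2
      ≤ ∑ s ∈ 𝒮, ∫ u in Set.Ioc (τ s - δ / 2) (τ s + δ / 2),
          ((1 / δ + L) * ‖f u‖ ^ 2 + ‖f' u‖ ^ 2 / L) :=
        Finset.sum_le_sum fun s _ => norm_sq_le_integral_Ioc hf hf' hL hδ (τ s)
    _ = ∫ u in ⋃ s ∈ 𝒮, Set.Ioc (τ s - δ / 2) (τ s + δ / 2),
          ((1 / δ + L) * ‖f u‖ ^ 2 + ‖f' u‖ ^ 2 / L) :=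
        (integral_biUnion_finset 𝒮 (fun _ _ => measurableSet_Ioc) hdisj
          fun _ _ => hinteg _ _ _ hF).symm
    _ ≤ ∫ u in Set.Ioc T₀ (T₀ + T), ((1 / δ + L) * ‖f u‖ ^ 2 + ‖f' u‖ ^ 2 / L) :=
        setIntegral_mono_set (hinteg _ _ _ hF) (Eventually.of_forall fun t => by dsimp; positivity)
          hsub.eventuallyLE
    _ = _ := by
        rw [integral_add (hinteg _ _ _ (by fun_prop)) (hinteg _ _ _ (by fun_prop)),
          integral_const_mul, integral_div]

end

section

variable {ι : Type*} [Fintype ι]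

lemma hasDerivAt_expPoly (b : ι → ℂ) (l : ι → ℝ) (s : ℂ) :
    HasDerivAt (expPoly b l) (expPoly (fun j => b j * -(l j : ℂ)) l s) s := by
  unfold expPoly
  refine HasDerivAt.fun_sum fun j _ => ?_
  have h := ((hasDerivAt_id' s).const_mul (-(l j : ℂ))).cexp.const_mul (b j)
  refine h.congr_deriv ?_
  ring

/-- Large sieve type inequality at well-spaced points of the imaginary axis. -/
lemma sum_norm_expPoly_sq_le (b : ι → ℂ) (l : ι → ℝ) {L δ T₀ T η : ℝ} (hL : 0 < L)
    (hl : ∀ j, |l j| ≤ 2 * L) (hδ : 0 < δ) (hT : 0 < T) (hη : 0 < η) {κ : Type*} (𝒮 : Finset κ)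
    (τ : κ → ℝ) (hτ : ∀ s ∈ 𝒮, T₀ + δ / 2 ≤ τ s ∧ τ s ≤ T₀ + T - δ / 2)
    (hsep : ∀ s ∈ 𝒮, ∀ s' ∈ 𝒮, s ≠ s' → δ ≤ |τ s - τ s'|) :
    ∑ s ∈ 𝒮, ‖expPoly b l (Complex.I * τ s)‖ ^ 2 ≤
      5 * (L + 1 / δ) * (meanValueConst * (T + 1 / η) *
        ∑ j, ((Finset.univ.filter fun i => |l j - l i| ≤ η / 2).card : ℝ) * ‖b j‖ ^ 2) := by
  have hder : ∀ t : ℝ, HasDerivAt (fun t : ℝ => expPoly b l (Complex.I * t))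
      (expPoly (fun j => b j * -(l j : ℂ)) l (Complex.I * t) * Complex.I) t := by
    intro t
    have h1 : HasDerivAt (fun t : ℝ => Complex.I * (t : ℂ)) Complex.I t := by
      simpa using (Complex.ofRealCLM.hasDerivAt (x := t)).const_mul Complex.I
    exact (hasDerivAt_expPoly b l (Complex.I * t)).comp t h1
  have hc := continuous_expPoly (fun j => b j * -(l j : ℂ)) l
  have hsum := sum_norm_sq_le_integral hder (by fun_prop) hL hδ 𝒮 τ hτ hsep
  have hM := meanValueConst_pos
  have hB := integral_norm_expPoly_sq_le b l T₀ hT hη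
  have hB' := integral_norm_expPoly_sq_le (fun j => b j * -(l j : ℂ)) l T₀ hT hη
  set W := ∑ j, ((Finset.univ.filter fun i => |l j - l i| ≤ η / 2).card : ℝ) * ‖b j‖ ^ 2 with hW
  have hW' : ∑ j, ((Finset.univ.filter fun i => |l j - l i| ≤ η / 2).card : ℝ) *
      ‖b j * -(l j : ℂ)‖ ^ 2 ≤ 4 * L ^ 2 * W := by
    rw [hW, Finset.mul_sum]
    refine Finset.sum_le_sum fun j _ => ?_
    rw [norm_mul, norm_neg, Complex.norm_real, Real.norm_eq_abs, mul_pow]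
    have : |l j| ^ 2 ≤ 4 * L ^ 2 := by nlinarith [hl j, abs_nonneg (l j)]
    calc _ ≤ ((Finset.univ.filter fun i => |l j - l i| ≤ η / 2).card : ℝ) *
          (‖b j‖ ^ 2 * (4 * L ^ 2)) := by gcongr
      _ = _ := by ring
  simp only [norm_mul, Complex.norm_I, mul_one] at hsum
  set V := meanValueConst * (T + 1 / η) with hV
  have hVpos : 0 < V := by positivity
  have hWnn : 0 ≤ W := Finset.sum_nonneg fun j _ => by positivity
  have hB'' : (∫ t in Set.Ioc T₀ (T₀ + T),
      ‖expPoly (fun j => b j * -(l j : ℂ)) l (Complex.I * t)‖ ^ 2) / L ≤ 4 * L * (V * W) := by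
    rw [div_le_iff₀ hL]
    refine hB'.trans ((mul_le_mul_of_nonneg_left hW' hVpos.le).trans (le_of_eq ?_))
    ring
  have hδ' : 0 < 1 / δ := by positivity
  have hB1 := mul_le_mul_of_nonneg_left hB (by positivity : 0 ≤ 1 / δ + L)
  have : 0 ≤ 1 / δ * (V * W) := mul_nonneg hδ'.le (mul_nonneg hVpos.le hWnn)
  linarith

/-- Large sieve type inequality at well-spaced points of a vertical line. -/
lemma sum_norm_expPoly_sq_le_of_re (b : ι → ℂ) (l : ι → ℝ) {L δ T₀ T η u : ℝ} (hL : 0 < L)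
    (hl : ∀ j, L ≤ l j) (hl' : ∀ j, l j ≤ 2 * L) (hu : 0 ≤ u) (hδ : 0 < δ) (hT : 0 < T)
    (hη : 0 < η) {κ : Type*} (𝒮 : Finset κ) (τ : κ → ℝ)
    (hτ : ∀ s ∈ 𝒮, T₀ + δ / 2 ≤ τ s ∧ τ s ≤ T₀ + T - δ / 2)
    (hsep : ∀ s ∈ 𝒮, ∀ s' ∈ 𝒮, s ≠ s' → δ ≤ |τ s - τ s'|) :
    ∑ s ∈ 𝒮, ‖expPoly b l (u + Complex.I * τ s)‖ ^ 2 ≤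
      5 * (L + 1 / δ) * (meanValueConst * (T + 1 / η) *
        ∑ j, ((Finset.univ.filter fun i => |l j - l i| ≤ η / 2).card : ℝ) * ‖b j‖ ^ 2)
        * Real.exp (-(2 * L * u)) := by
  have h := sum_norm_expPoly_sq_le (fun j => b j * Complex.exp (-(l j : ℂ) * u)) l hL
    (fun j => abs_le.mpr ⟨by linarith [hl j], hl' j⟩) hδ hT hη 𝒮 τ hτ hsep
  have hs : ∀ t : ℝ, expPoly (fun j => b j * Complex.exp (-(l j : ℂ) * u)) l (Complex.I * t) =
      expPoly b l (u + Complex.I * t) := by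
    intro t
    unfold expPoly
    refine Finset.sum_congr rfl fun j _ => ?_
    rw [mul_assoc, ← Complex.exp_add, mul_add]
  simp only [hs] at h
  have hM := meanValueConst_pos
  refine h.trans ?_
  rw [mul_assoc (5 * (L + 1 / δ)), mul_assoc (meanValueConst * (T + 1 / η)), Finset.sum_mul]
  refine mul_le_mul_of_nonneg_left (mul_le_mul_of_nonneg_left (Finset.sum_le_sum fun j _ => ?_)
    (by positivity)) (by positivity)
  rw [mul_assoc, norm_mul, mul_pow]
  refine mul_le_mul_of_nonneg_left (mul_le_mul_of_nonneg_left ?_ (sq_nonneg _)) (Nat.cast_nonneg _)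
  rw [Complex.norm_exp, ← Real.exp_nat_mul]
  refine Real.exp_le_exp.mpr ?_
  simp only [← Complex.ofReal_neg, ← Complex.ofReal_mul, Complex.ofReal_re]
  push_cast
  nlinarith [hl j]

/-- Discrete mean value theorem for generalized Dirichlet polynomials with frequencies in
`[L, 2L]`, at points of a half plane with well-spaced imaginary parts. -/
lemma sum_norm_expPoly_sq_le_of_le_re (b : ι → ℂ) (l : ι → ℝ) {L δ T₀ T η α : ℝ} (hL : 0 < L)
    (hl : ∀ j, L ≤ l j) (hl' : ∀ j, l j ≤ 2 * L) (hα : 0 ≤ α) (hδ : 0 < δ) (hT : 0 < T)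
    (hη : 0 < η) (𝒮 : Finset ℂ)
    (h𝒮 : ∀ s ∈ 𝒮, α ≤ s.re ∧ T₀ + δ / 2 ≤ s.im ∧ s.im ≤ T₀ + T - δ / 2)
    (hsep : ∀ s ∈ 𝒮, ∀ s' ∈ 𝒮, s ≠ s' → δ ≤ |s.im - s'.im|) :
    ∑ s ∈ 𝒮, ‖expPoly b l s‖ ^ 2 ≤
      18 * (L + 1 / δ) * (meanValueConst * (T + 1 / η) *
        ∑ j, ((Finset.univ.filter fun i => |l j - l i| ≤ η / 2).card : ℝ) * ‖b j‖ ^ 2)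
        * Real.exp (-(2 * L * α)) := by
  set b' : ι → ℂ := fun j => b j * -(l j : ℂ) with hb'
  have hM := meanValueConst_pos
  obtain ⟨M, hαM, hM𝒮⟩ : ∃ M, α ≤ M ∧ ∀ s ∈ 𝒮, s.re ≤ M := by
    obtain ⟨M, hM⟩ := (𝒮.image Complex.re).bddAbove
    exact ⟨max α M, le_max_left _ _, fun s hs => (hM (by simpa using ⟨s, hs, rfl⟩)).trans
      (le_max_right _ _)⟩
  have hcont := continuous_expPoly b l
  have hcont' := continuous_expPoly b' l
  have hinteg : ∀ g : ℝ → ℝ, Continuous g → IntegrableOn g (Set.Ioc α M) :=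
    fun g hg => hg.integrableOn_Icc.mono_set Set.Ioc_subset_Icc_self
  set W := ∑ j, ((Finset.univ.filter fun i => |l j - l i| ≤ η / 2).card : ℝ) * ‖b j‖ ^ 2 with hW
  have hWnn : 0 ≤ W := Finset.sum_nonneg fun j _ => by positivity
  set V := 5 * (L + 1 / δ) * (meanValueConst * (T + 1 / η) * W) with hV
  have hLδ : 0 ≤ L + 1 / δ := by positivity
  have hMT : 0 ≤ meanValueConst * (T + 1 / η) := by positivity
  have hVnn : 0 ≤ V := mul_nonneg (mul_nonneg (by norm_num) hLδ) (mul_nonneg hMT hWnn)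
  have hline : ∀ u : ℝ, 0 ≤ u → ∑ s ∈ 𝒮, ‖expPoly b l (u + Complex.I * s.im)‖ ^ 2 ≤
      V * Real.exp (-(2 * L * u)) := fun u hu =>
    sum_norm_expPoly_sq_le_of_re b l hL hl hl' hu hδ hT hη 𝒮 Complex.im
      (fun s hs => (h𝒮 s hs).2) hsep
  have hline' : ∀ u : ℝ, 0 ≤ u → ∑ s ∈ 𝒮, ‖expPoly b' l (u + Complex.I * s.im)‖ ^ 2 ≤
      4 * L ^ 2 * V * Real.exp (-(2 * L * u)) := by
    intro u hu
    refine (sum_norm_expPoly_sq_le_of_re b' l hL hl hl' hu hδ hT hη 𝒮 Complex.im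
      (fun s hs => (h𝒮 s hs).2) hsep).trans ?_
    have hW' : ∑ j, ((Finset.univ.filter fun i => |l j - l i| ≤ η / 2).card : ℝ) *
        ‖b' j‖ ^ 2 ≤ 4 * L ^ 2 * W := by
      rw [hW, Finset.mul_sum]
      refine Finset.sum_le_sum fun j _ => ?_
      rw [hb', norm_mul, norm_neg, Complex.norm_real, Real.norm_eq_abs, mul_pow, sq_abs]
      have : l j ^ 2 ≤ 4 * L ^ 2 := by nlinarith [hl j, hl' j]
      calc _ ≤ ((Finset.univ.filter fun i => |l j - l i| ≤ η / 2).card : ℝ) *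
            (‖b j‖ ^ 2 * (4 * L ^ 2)) := by gcongr
        _ = _ := by ring
    calc _ ≤ 5 * (L + 1 / δ) * (meanValueConst * (T + 1 / η) * (4 * L ^ 2 * W)) *
          Real.exp (-(2 * L * u)) := by gcongr
      _ = _ := by rw [hV]; ring
  have hpt : ∀ s ∈ 𝒮, ‖expPoly b l s‖ ^ 2 ≤ ‖expPoly b l (α + Complex.I * s.im)‖ ^ 2 +
      ∫ u in Set.Ioc α M, (L * ‖expPoly b l (u + Complex.I * s.im)‖ ^ 2 +
        ‖expPoly b' l (u + Complex.I * s.im)‖ ^ 2 / L) := by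
    intro s hs
    have hder : ∀ u : ℝ, HasDerivAt (fun u : ℝ => expPoly b l (u + Complex.I * s.im))
        (expPoly b' l (u + Complex.I * s.im)) u := by
      intro u
      have h1 : HasDerivAt (fun u : ℝ => (u : ℂ) + Complex.I * s.im) 1 u := by
        simpa using (Complex.ofRealCLM.hasDerivAt (x := u)).add_const (Complex.I * s.im)
      exact ((hasDerivAt_expPoly b l (u + Complex.I * s.im)).comp u h1).congr_deriv (mul_one _)
    have h := norm_sq_le_norm_sq_add_integral hder (by fun_prop) hL (p := α) (q := M)
      (x := s.re) (y := α) ⟨(h𝒮 s hs).1, hM𝒮 s hs⟩ ⟨le_rfl, hαM⟩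
    rwa [show (s.re : ℂ) + Complex.I * s.im = s by rw [mul_comm]; exact Complex.re_add_im s] at h
  have hexp : ∫ u in Set.Ioc α M, 2 * L * Real.exp (-(2 * L * u)) ≤ Real.exp (-(2 * L * α)) := by
    rw [← intervalIntegral.integral_of_le hαM]
    have : ∀ u ∈ Set.uIcc α M, HasDerivAt (fun u => -Real.exp (-(2 * L * u)))
        (2 * L * Real.exp (-(2 * L * u))) u := by
      intro u _
      have h := ((hasDerivAt_id' u).const_mul (2 * L)).fun_neg.exp.fun_neg
      refine h.congr_deriv ?_
      ring
    rw [intervalIntegral.integral_eq_sub_of_hasDerivAt this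
      (Continuous.intervalIntegrable (by fun_prop) _ _)]
    linarith [Real.exp_pos (-(2 * L * M))]
  have hsumint : ∑ s ∈ 𝒮, ∫ u in Set.Ioc α M, (L * ‖expPoly b l (u + Complex.I * s.im)‖ ^ 2 +
        ‖expPoly b' l (u + Complex.I * s.im)‖ ^ 2 / L) ≤ 5 / 2 * V * Real.exp (-(2 * L * α)) := by
    rw [← integral_finsetSum _ fun s _ => hinteg _ (by fun_prop)]
    calc _ ≤ ∫ u in Set.Ioc α M, 5 / 2 * V * (2 * L * Real.exp (-(2 * L * u))) := by
          refine setIntegral_mono_on (hinteg _ (by fun_prop)) (hinteg _ (by fun_prop))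
            measurableSet_Ioc fun u hu => ?_
          have hu0 : 0 ≤ u := hα.trans hu.1.le
          rw [Finset.sum_add_distrib, ← Finset.mul_sum, ← Finset.sum_div]
          have h1 := mul_le_mul_of_nonneg_left (hline u hu0) hL.le
          have h2 : (∑ s ∈ 𝒮, ‖expPoly b' l (u + Complex.I * s.im)‖ ^ 2) / L ≤
              4 * L * V * Real.exp (-(2 * L * u)) := by
            rw [div_le_iff₀ hL]
            refine (hline' u hu0).trans (le_of_eq ?_)
            ring
          linarith
      _ ≤ _ := by
          rw [integral_const_mul]
          exact mul_le_mul_of_nonneg_left hexp (mul_nonneg (by norm_num) hVnn)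
  have h0 : 0 ≤ (L + 1 / δ) * (meanValueConst * (T + 1 / η) * W) * Real.exp (-(2 * L * α)) :=
    mul_nonneg (mul_nonneg hLδ (mul_nonneg hMT hWnn)) (Real.exp_pos _).le
  calc _ ≤ _ := Finset.sum_le_sum hpt
    _ ≤ V * Real.exp (-(2 * L * α)) + 5 / 2 * V * Real.exp (-(2 * L * α)) := by
        rw [Finset.sum_add_distrib]
        exact add_le_add (hline α hα) hsumint
    _ ≤ _ := by
        rw [hV]
        linarith

end

lemma abs_sub_le_mul_abs_log_sub_log {x y B : ℝ} (hx : 0 < x) (hy : 0 < y) (hxB : x ≤ B)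
    (hyB : y ≤ B) : |x - y| ≤ B * |Real.log x - Real.log y| := by
  wlog h : y ≤ x generalizing x y
  · rw [abs_sub_comm x, abs_sub_comm (Real.log x)]
    exact this hy hx hyB hxB (not_le.mp h).le
  have h1 := Real.one_sub_inv_le_log_of_pos (div_pos hx hy)
  rw [Real.log_div hx.ne' hy.ne', inv_div] at h1
  have h2 : 0 ≤ Real.log x - Real.log y := sub_nonneg.mpr (Real.log_le_log hy h)
  rw [abs_of_nonneg (sub_nonneg.mpr h), abs_of_nonneg h2]
  calc x - y = x * (1 - y / x) := by field_simp
    _ ≤ x * (Real.log x - Real.log y) := by gcongr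
    _ ≤ _ := by gcongr

/-- Theorem 2.3: discrete mean value theorem for general Dirichlet polynomials over a
set of complex points with `δ`-well-spaced imaginary parts and real parts `≥ α`.
`χ(x, λ) = #{j : |x - n_j| ≤ λ}`. -/
theorem discrete_mvt_complex_points :
    ∃ C : ℝ, 0 < C ∧
      ∀ (α δ T₀ T : ℝ) (𝒮 : Finset ℂ), 0 < α → 0 < δ → 0 < T →
        (∀ s ∈ 𝒮, α ≤ s.re ∧ T₀ + δ / 2 ≤ s.im ∧ s.im ≤ T₀ + T - δ / 2) →
        (∀ s ∈ 𝒮, ∀ s' ∈ 𝒮, s ≠ s' → δ ≤ |s.im - s'.im|) →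
        ∀ (N : ℝ) (J : ℕ) (n : Fin J → ℝ) (a : Fin J → ℂ),
          2 ≤ N → Monotone n → (∀ j, N ≤ n j) → (∀ j, n j ≤ 2 * N) →
          ∀ η : ℝ, 0 < η →
            (∑ s ∈ 𝒮, ‖∑ j, a j * (n j : ℂ) ^ (-s)‖ ^ 2) ≤
              C * (T + 1 / η) * (Real.log N + 1 / δ) *
                ∑ j, ((Finset.univ.filter fun i => |n j - n i| ≤ η * N).card : ℝ)
                  * ‖a j‖ ^ 2 / N ^ (2 * α) := by
  refine ⟨18 * meanValueConst, by linarith [meanValueConst_pos], ?_⟩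
  intro α δ T₀ T 𝒮 hα hδ hT h𝒮 hsep N J n a hN _ hnN hn2N η hη
  have hM := meanValueConst_pos
  have hN0 : 0 < N := by linarith
  have hn0 : ∀ j, 0 < n j := fun j => hN0.trans_le (hnN j)
  have hL : 0 < Real.log N := Real.log_pos (by linarith)
  have hl : ∀ j, Real.log N ≤ Real.log (n j) := fun j => Real.log_le_log hN0 (hnN j)
  have hl' : ∀ j, Real.log (n j) ≤ 2 * Real.log N := by
    intro j
    have h : Real.log (n j) ≤ Real.log (N * N) :=
      Real.log_le_log (hn0 j) ((hn2N j).trans (by nlinarith))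
    rw [Real.log_mul hN0.ne' hN0.ne'] at h
    linarith
  have hpoly : ∀ s : ℂ, ∑ j, a j * (n j : ℂ) ^ (-s) = expPoly a (fun j => Real.log (n j)) s := by
    intro s
    unfold expPoly
    refine Finset.sum_congr rfl fun j _ => ?_
    rw [Complex.cpow_def_of_ne_zero (by exact_mod_cast (hn0 j).ne'), ← Complex.ofReal_log (hn0 j).le]
    congr 2
    ring
  simp only [hpoly]
  refine (sum_norm_expPoly_sq_le_of_le_re a (fun j => Real.log (n j)) hL hl hl' hα.le hδ hT hη 𝒮
    h𝒮 hsep).trans ?_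
  have hpow : Real.exp (-(2 * Real.log N * α)) = 1 / N ^ (2 * α) := by
    rw [Real.rpow_def_of_pos hN0, Real.exp_neg, one_div]
    congr 2
    ring
  have hW : ∑ j, ((Finset.univ.filter fun i => |Real.log (n j) - Real.log (n i)| ≤ η / 2).card : ℝ)
        * ‖a j‖ ^ 2 ≤
      ∑ j, ((Finset.univ.filter fun i => |n j - n i| ≤ η * N).card : ℝ) * ‖a j‖ ^ 2 := by
    refine Finset.sum_le_sum fun j _ => mul_le_mul_of_nonneg_right
      (Nat.cast_le.mpr (Finset.card_le_card fun i hi => ?_)) (sq_nonneg _)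
    simp only [Finset.mem_filter, Finset.mem_univ, true_and] at hi ⊢
    have := abs_sub_le_mul_abs_log_sub_log (hn0 j) (hn0 i) (hn2N j) (hn2N i)
    nlinarith
  rw [hpow, ← Finset.sum_div]
  calc _ ≤ 18 * (Real.log N + 1 / δ) * (meanValueConst * (T + 1 / η) *
        ∑ j, ((Finset.univ.filter fun i => |n j - n i| ≤ η * N).card : ℝ) * ‖a j‖ ^ 2) *
        (1 / N ^ (2 * α)) := by gcongr
    _ = _ := by ring
end
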